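/- The optimal values of the control problems are related to the optimal values of the IDLP problems as follows: (i) h_ε(y0) = k*(ε,y0) for all ε ∈ (0,1) and y0 ∈ Y; (ii) lim_{ε→0} min_{y0∈Y} h_ε(y0) = k*; (iii) lim_{T→∞} min_{y0∈Y} v_T(y0) = k*. -/

import Mathlib

open MeasureTheory Filter Set Topology
open scoped ENNReal NNReal

noncomputable section

namespace StochLP

/-- The model of the controlled stochastic discrete time system (controlled stochastic
recursion) `y(t+1) = f(y(t), u(t), s(t))` from the paper: `Y ⊂ ℝⁿ` is a compact forward
invariant state constraint set, `Uc` is a compact metric control space, `S` is a Polish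
noise space, `U` is an upper semicontinuous compact valued control constraint
multifunction (upper semicontinuity of a compact valued map into a compact space being
recorded as closedness of its graph), `f` is bounded, continuous in `(y,u)` and Borel
measurable in `s`, and `ν` is the common law of the i.i.d. noise elements `s(t)`. -/
structure Model (n : ℕ) (Uc S : Type) [MetricSpace Uc] [CompactSpace Uc]
    [MeasurableSpace Uc] [BorelSpace Uc] [TopologicalSpace S] [PolishSpace S]
    [MeasurableSpace S] [BorelSpace S] where
  Y : Set (Fin n → ℝ)
  U : (Fin n → ℝ) → Set Uc
  f : (Fin n → ℝ) → Uc → S → (Fin n → ℝ)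
  ν : Measure S
  ν_prob : IsProbabilityMeasure ν
  Y_compact : IsCompact Y
  Y_nonempty : Y.Nonempty
  U_nonempty : ∀ y ∈ Y, (U y).Nonempty
  U_compact : ∀ y ∈ Y, IsCompact (U y)
  graph_closed : IsClosed {p : (Fin n → ℝ) × Uc | p.1 ∈ Y ∧ p.2 ∈ U p.1}
  f_bounded : ∃ C : ℝ, ∀ y ∈ Y, ∀ (u : Uc) (s : S), ‖f y u s‖ ≤ C
  f_cont : ∀ s : S, ContinuousOn (fun p : (Fin n → ℝ) × Uc => f p.1 p.2 s) (Y ×ˢ univ)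
  f_meas : ∀ y ∈ Y, ∀ u : Uc, Measurable fun s => f y u s
  f_inv : ∀ y ∈ Y, ∀ u ∈ U y, ∀ s : S, f y u s ∈ Y

variable {n : ℕ} {Uc S : Type} [MetricSpace Uc] [CompactSpace Uc] [MeasurableSpace Uc]
  [BorelSpace Uc] [TopologicalSpace S] [PolishSpace S] [MeasurableSpace S] [BorelSpace S]

/-- A control plan: a sequence of Borel measurable selections of the multifunction `U`. -/
structure Plan (M : Model n Uc S) where
  π : ℕ → (Fin n → ℝ) → Uc
  measurable : ∀ t, Measurable (π t)
  feasible : ∀ t, ∀ y ∈ M.Y, π t y ∈ M.U y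

/-- The law of the state `y^{π,y₀}(t)` of the controlled stochastic recursion started at
`y₀` and driven by the i.i.d. noise with common law `ν`, defined by the Markov recursion.  -/
def stateLaw (M : Model n Uc S) (t : ℕ) :
    (ℕ → (Fin n → ℝ) → Uc) → (Fin n → ℝ) → Measure (Fin n → ℝ) :=
  Nat.rec (motive := fun _ => (ℕ → (Fin n → ℝ) → Uc) → (Fin n → ℝ) → Measure (Fin n → ℝ))
    (fun _ y => Measure.dirac y)
    (fun _ ih π y =>
      (M.ν.map fun s => M.f y (π 0 y) s).bind fun y' => ih (fun j => π (j + 1)) y') t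

/-- The joint law of the state-control pair `(y^{π,y₀}(t), u^{π,y₀}(t))`. -/
def saLaw (M : Model n Uc S) (t : ℕ) (π : ℕ → (Fin n → ℝ) → Uc) (y0 : Fin n → ℝ) :
    Measure ((Fin n → ℝ) × Uc) :=
  (stateLaw M t π y0).map fun z => (z, π t z)

/-- `E[q(y^{π,y₀}(t), u^{π,y₀}(t))]`. -/
def expSA (M : Model n Uc S) (t : ℕ) (π : ℕ → (Fin n → ℝ) → Uc) (y0 : Fin n → ℝ)
    (q : (Fin n → ℝ) → Uc → ℝ) : ℝ :=
  ∫ p, q p.1 p.2 ∂saLaw M t π y0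

/-- The finite horizon average expected cost `(1/T) E[Σ_{t=0}^{T-1} k(y(t),u(t))]`. -/
def costT (M : Model n Uc S) (k : (Fin n → ℝ) → Uc → ℝ) (T : ℕ) (π : ℕ → (Fin n → ℝ) → Uc)
    (y0 : Fin n → ℝ) : ℝ :=
  (1 / (T : ℝ)) * ∑ t ∈ Finset.range T, expSA M t π y0 k

/-- The optimal value `v_T(y₀)` of the finite horizon problem. -/
def vT (M : Model n Uc S) (k : (Fin n → ℝ) → Uc → ℝ) (T : ℕ) (y0 : Fin n → ℝ) : ℝ :=
  ⨅ π : Plan M, costT M k T π.π y0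

/-- The expected discounted cost `ε Σ_{t=0}^∞ (1-ε)^t E[k(y(t),u(t))]`. -/
def costDisc (M : Model n Uc S) (k : (Fin n → ℝ) → Uc → ℝ) (ε : ℝ)
    (π : ℕ → (Fin n → ℝ) → Uc) (y0 : Fin n → ℝ) : ℝ :=
  ε * ∑' t : ℕ, (1 - ε) ^ t * expSA M t π y0 k

/-- The optimal value `h_ε(y₀)` of the discounted problem. -/
def hEps (M : Model n Uc S) (k : (Fin n → ℝ) → Uc → ℝ) (ε : ℝ) (y0 : Fin n → ℝ) : ℝ :=
  ⨅ π : Plan M, costDisc M k ε π.π y0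

/-- The graph `G` of the multifunction `U`. -/
def graphG (M : Model n Uc S) : Set ((Fin n → ℝ) × Uc) := {p | p.1 ∈ M.Y ∧ p.2 ∈ M.U p.1}

/-- `E[φ(f(y,u,s))]`, the expectation over the noise of `φ` evaluated after one step. -/
def Ef (M : Model n Uc S) (φ : (Fin n → ℝ) → ℝ) (y : Fin n → ℝ) (u : Uc) : ℝ :=
  ∫ s, φ (M.f y u s) ∂M.ν

/-- A measure on `Y × Uc` is concentrated on the graph `G` (this encodes measures defined
on Borel subsets of `G`). -/
def onG (M : Model n Uc S) (γ : Measure ((Fin n → ℝ) × Uc)) : Prop := γ (graphG M)ᶜ = 0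

/-- The set `W` of stationary measures. -/
def Wset (M : Model n Uc S) : Set (Measure ((Fin n → ℝ) × Uc)) :=
  {γ | IsProbabilityMeasure γ ∧ onG M γ ∧
    ∀ φ : (Fin n → ℝ) → ℝ, Continuous φ → ∫ p, (Ef M φ p.1 p.2 - φ p.1) ∂γ = 0}

/-- The set `W(ε, y₀)` of discounted stationary measures. -/
def Weps (M : Model n Uc S) (ε : ℝ) (y0 : Fin n → ℝ) : Set (Measure ((Fin n → ℝ) × Uc)) :=
  {γ | IsProbabilityMeasure γ ∧ onG M γ ∧
    ∀ φ : (Fin n → ℝ) → ℝ, Continuous φ →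
      ∫ p, ((1 - ε) * (Ef M φ p.1 p.2 - φ p.1) + ε * (φ y0 - φ p.1)) ∂γ = 0}

/-- The optimal value `k*(ε, y₀)` of the IDLP problem over `W(ε, y₀)`. -/
def kStarEps (M : Model n Uc S) (k : (Fin n → ℝ) → Uc → ℝ) (ε : ℝ) (y0 : Fin n → ℝ) : ℝ :=
  sInf ((fun γ : Measure ((Fin n → ℝ) × Uc) => ∫ p, k p.1 p.2 ∂γ) '' Weps M ε y0)

/-- The optimal value `k*` of the IDLP problem over `W`. -/
def kStar (M : Model n Uc S) (k : (Fin n → ℝ) → Uc → ℝ) : ℝ :=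
  sInf ((fun γ : Measure ((Fin n → ℝ) × Uc) => ∫ p, k p.1 p.2 ∂γ) '' Wset M)

/-- The optimal value `μ*(ε, y₀)` of the problem dual to the IDLP problem over `W(ε,y₀)`. -/
def muStarEps (M : Model n Uc S) (k : (Fin n → ℝ) → Uc → ℝ) (ε : ℝ) (y0 : Fin n → ℝ) : ℝ :=
  sSup {r : ℝ | ∃ ψ : (Fin n → ℝ) → ℝ, Continuous ψ ∧
    r = sInf ((fun p : (Fin n → ℝ) × Uc =>
      k p.1 p.2 + (1 - ε) * (Ef M ψ p.1 p.2 - ψ p.1) + ε * (ψ y0 - ψ p.1)) '' graphG M)}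

/-- The optimal value `μ*` of the problem dual to the IDLP problem over `W`. -/
def muStar (M : Model n Uc S) (k : (Fin n → ℝ) → Uc → ℝ) : ℝ :=
  sSup {r : ℝ | ∃ ψ : (Fin n → ℝ) → ℝ, Continuous ψ ∧
    r = sInf ((fun p : (Fin n → ℝ) × Uc => k p.1 p.2 + Ef M ψ p.1 p.2 - ψ p.1) '' graphG M)}

/-- The feasible set `Ω(y₀)` of the augmented IDLP problem. -/
def OmegaSet (M : Model n Uc S) (y0 : Fin n → ℝ) :
    Set (Measure ((Fin n → ℝ) × Uc) × Measure ((Fin n → ℝ) × Uc)) :=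
  {p | p.1 ∈ Wset M ∧ IsFiniteMeasure p.2 ∧ onG M p.2 ∧
    ∀ φ : (Fin n → ℝ) → ℝ, Continuous φ →
      ∫ q, (φ y0 - φ q.1) ∂p.1 + ∫ q, (Ef M φ q.1 q.2 - φ q.1) ∂p.2 = 0}

/-- The optimal value `k*(y₀)` of the augmented IDLP problem. -/
def kStarAug (M : Model n Uc S) (k : (Fin n → ℝ) → Uc → ℝ) (y0 : Fin n → ℝ) : ℝ :=
  sInf ((fun p : Measure ((Fin n → ℝ) × Uc) × Measure ((Fin n → ℝ) × Uc) =>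
    ∫ q, k q.1 q.2 ∂p.1) '' OmegaSet M y0)

/-- Feasibility of `(μ, ψ, η)` for the problem dual to the augmented IDLP problem. -/
def DualFeas (M : Model n Uc S) (k : (Fin n → ℝ) → Uc → ℝ) (y0 : Fin n → ℝ)
    (ψ η : (Fin n → ℝ) → ℝ) (μ : ℝ) : Prop :=
  (∀ p ∈ graphG M, 0 ≤ k p.1 p.2 + (ψ y0 - ψ p.1) + Ef M η p.1 p.2 - η p.1 - μ) ∧
  (∀ p ∈ graphG M, 0 ≤ Ef M ψ p.1 p.2 - ψ p.1)

/-- The optimal value `d*(y₀)` of the dual (with continuous test functions) of the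
augmented IDLP problem. -/
def dStar (M : Model n Uc S) (k : (Fin n → ℝ) → Uc → ℝ) (y0 : Fin n → ℝ) : ℝ :=
  sSup {μ : ℝ | ∃ ψ η : (Fin n → ℝ) → ℝ, Continuous ψ ∧ Continuous η ∧
    DualFeas M k y0 ψ η μ}

/-- Bounded Borel measurable real valued functions. -/
def BddBorel (ψ : (Fin n → ℝ) → ℝ) : Prop := Measurable ψ ∧ ∃ C : ℝ, ∀ y, |ψ y| ≤ C

/-- The optimal value `d̂*(y₀)` of the relaxed dual (with bounded Borel test functions) of
the augmented IDLP problem. -/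
def dHatStar (M : Model n Uc S) (k : (Fin n → ℝ) → Uc → ℝ) (y0 : Fin n → ℝ) : ℝ :=
  sSup {μ : ℝ | ∃ ψ η : (Fin n → ℝ) → ℝ, BddBorel ψ ∧ BddBorel η ∧ DualFeas M k y0 ψ η μ}

/-- The occupational measure `γ^{π,y₀,T}`. -/
def occT (M : Model n Uc S) (T : ℕ) (π : ℕ → (Fin n → ℝ) → Uc) (y0 : Fin n → ℝ) :
    Measure ((Fin n → ℝ) × Uc) :=
  (T : ℝ≥0∞)⁻¹ • ∑ t ∈ Finset.range T, saLaw M t π y0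

/-- The discounted occupational measure `γ_d^{π,y₀,ε}`. -/
def discOcc (M : Model n Uc S) (ε : ℝ) (π : ℕ → (Fin n → ℝ) → Uc) (y0 : Fin n → ℝ) :
    Measure ((Fin n → ℝ) × Uc) :=
  ENNReal.ofReal ε • Measure.sum fun t : ℕ => ENNReal.ofReal (1 - ε) ^ t • saLaw M t π y0

/-- The set `Θ_ε(y₀)` of discounted occupational measures, as a set of probability
measures (carrying the topology of weak convergence). -/
def ThetaEps (M : Model n Uc S) (ε : ℝ) (y0 : Fin n → ℝ) :
    Set (ProbabilityMeasure ((Fin n → ℝ) × Uc)) :=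
  {μ | ∃ π : Plan M, μ.toMeasure = discOcc M ε π.π y0}

/-- `Θ_ε := ∪_{y₀ ∈ Y} Θ_ε(y₀)`. -/
def ThetaEpsAll (M : Model n Uc S) (ε : ℝ) : Set (ProbabilityMeasure ((Fin n → ℝ) × Uc)) :=
  ⋃ y0 ∈ M.Y, ThetaEps M ε y0

/-- The set `Γ_T(y₀)` of occupational measures. -/
def GammaT (M : Model n Uc S) (T : ℕ) (y0 : Fin n → ℝ) :
    Set (ProbabilityMeasure ((Fin n → ℝ) × Uc)) :=
  {μ | ∃ π : Plan M, μ.toMeasure = occT M T π.π y0}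

/-- `Γ_T := ∪_{y₀ ∈ Y} Γ_T(y₀)`. -/
def GammaTAll (M : Model n Uc S) (T : ℕ) : Set (ProbabilityMeasure ((Fin n → ℝ) × Uc)) :=
  ⋃ y0 ∈ M.Y, GammaT M T y0

/-- `W` as a set of probability measures. -/
def WsetPM (M : Model n Uc S) : Set (ProbabilityMeasure ((Fin n → ℝ) × Uc)) :=
  {μ | μ.toMeasure ∈ Wset M}

/-- `W(ε,y₀)` as a set of probability measures. -/
def WepsPM (M : Model n Uc S) (ε : ℝ) (y0 : Fin n → ℝ) :
    Set (ProbabilityMeasure ((Fin n → ℝ) × Uc)) :=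
  {μ | μ.toMeasure ∈ Weps M ε y0}

/-- The set of finite convex combinations of elements of a set of probability measures,
i.e. its convex hull. -/
def convexCombos {α : Type*} [MeasurableSpace α] (A : Set (ProbabilityMeasure α)) :
    Set (ProbabilityMeasure α) :=
  {μ | ∃ (m : ℕ) (w : Fin m → ℝ≥0) (γ : Fin m → ProbabilityMeasure α),
    (∀ i, γ i ∈ A) ∧ (∑ i, w i) = 1 ∧
    μ.toMeasure = ∑ i, (w i : ℝ≥0∞) • (γ i).toMeasure}

/-- Membership in the set `D₁(y₀)`. -/
def D1mem (M : Model n Uc S) (y0 : Fin n → ℝ) (γ : Measure ((Fin n → ℝ) × Uc)) : Prop :=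
  ∃ ξ : ℕ → Measure ((Fin n → ℝ) × Uc),
    (∀ l, IsFiniteMeasure (ξ l) ∧ onG M (ξ l)) ∧
    ∀ φ : (Fin n → ℝ) → ℝ, Continuous φ →
      Tendsto (fun l => ∫ q, (Ef M φ q.1 q.2 - φ q.1) ∂ξ l) atTop
        (𝓝 (∫ q, (φ q.1 - φ y0) ∂γ))

/-- A control plan is periodic regime generating (PRG) for the initial point `y₀`. -/
def IsPRG (M : Model n Uc S) (π : Plan M) (y0 : Fin n → ℝ) : Prop :=
  ∃ T0 Tp : ℕ, 0 < Tp ∧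
    ∀ q : ((Fin n → ℝ) × Uc) → ℝ, Continuous q →
      ∀ t, T0 ≤ t → ∫ p, q p ∂saLaw M t π.π y0 = ∫ p, q p ∂saLaw M (t + Tp) π.π y0

/-- The optimal value `V_per(y₀)` over periodic regime generating control plans. -/
def Vper (M : Model n Uc S) (k : (Fin n → ℝ) → Uc → ℝ) (y0 : Fin n → ℝ) : ℝ :=
  sInf {c : ℝ | ∃ π : Plan M, IsPRG M π y0 ∧
    Tendsto (fun T => costT M k T π.π y0) atTop (𝓝 c)}

/-- The optimal value `k*_θ(y₀)` of the perturbed augmented IDLP problem. -/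
def kStarTheta (M : Model n Uc S) (k θ : (Fin n → ℝ) → Uc → ℝ) (y0 : Fin n → ℝ) : ℝ :=
  sInf ((fun p : Measure ((Fin n → ℝ) × Uc) × Measure ((Fin n → ℝ) × Uc) =>
    ∫ q, k q.1 q.2 ∂p.1 + ∫ q, θ q.1 q.2 ∂p.2) '' OmegaSet M y0)

/-- Feasibility of `(μ, ψ, η)` for the perturbed dual problem. -/
def DualFeasTheta (M : Model n Uc S) (k θ : (Fin n → ℝ) → Uc → ℝ) (y0 : Fin n → ℝ)
    (ψ η : (Fin n → ℝ) → ℝ) (μ : ℝ) : Prop :=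
  (∀ p ∈ graphG M, 0 ≤ k p.1 p.2 + (ψ y0 - ψ p.1) + Ef M η p.1 p.2 - η p.1 - μ) ∧
  (∀ p ∈ graphG M, -θ p.1 p.2 ≤ Ef M ψ p.1 p.2 - ψ p.1)

/-- The optimal value `d*_θ(y₀)` of the perturbed dual problem. -/
def dStarTheta (M : Model n Uc S) (k θ : (Fin n → ℝ) → Uc → ℝ) (y0 : Fin n → ℝ) : ℝ :=
  sSup {μ : ℝ | ∃ ψ η : (Fin n → ℝ) → ℝ, Continuous ψ ∧ Continuous η ∧
    DualFeasTheta M k θ y0 ψ η μ}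

/-- The optimal value `d̄*_θ(y₀)` of the second form of the perturbed dual problem. -/
def dBarTheta (M : Model n Uc S) (k θ : (Fin n → ℝ) → Uc → ℝ) (y0 : Fin n → ℝ) : ℝ :=
  sSup {r : ℝ | ∃ ψ η : (Fin n → ℝ) → ℝ, Continuous ψ ∧ Continuous η ∧ r = ψ y0 ∧
    (∀ p ∈ graphG M, 0 ≤ k p.1 p.2 - ψ p.1 + Ef M η p.1 p.2 - η p.1) ∧
    (∀ p ∈ graphG M, -θ p.1 p.2 ≤ Ef M ψ p.1 p.2 - ψ p.1)}

section Selection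

variable {X Γ : Type*} [TopologicalSpace X] [T2Space X] [TopologicalSpace Γ] [CompactSpace Γ]

/-- The optimal value of a lower semicontinuous cost over the part of a closed set lying in a
fibre depends lower semicontinuously on the base point. -/
theorem lowerSemicontinuous_iInf_fibre {p : Γ → X} (hp : Continuous p) {q : Γ → ℝ≥0∞}
    (hq : LowerSemicontinuous q) {A : Set Γ} (hA : IsClosed A) :
    LowerSemicontinuous fun x => ⨅ g ∈ A ∩ p ⁻¹' {x}, q g := by
  rw [lowerSemicontinuous_iff_isClosed_preimage]
  intro a
  by_cases ha : a = ⊤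
  · simp [ha]
  have : (fun x => ⨅ g ∈ A ∩ p ⁻¹' {x}, q g) ⁻¹' Iic a = p '' (A ∩ q ⁻¹' Iic a) := by
    ext x
    simp only [mem_preimage, mem_Iic, mem_image]
    constructor
    · intro h
      have hne : (A ∩ p ⁻¹' {x}).Nonempty := by
        by_contra hne
        rw [not_nonempty_iff_eq_empty] at hne
        simp [hne, ha] at h
      have hK : IsCompact (A ∩ p ⁻¹' {x}) := (hA.inter (isClosed_singleton.preimage hp)).isCompact
      obtain ⟨g, hg, hmin⟩ := (hq.lowerSemicontinuousOn _).exists_isMinOn hne hK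
      exact ⟨g, ⟨hg.1, le_trans (le_iInf₂ fun g' hg' => hmin hg') h⟩, hg.2⟩
    · rintro ⟨g, ⟨hgA, hga⟩, rfl⟩
      exact (iInf₂_le g ⟨hgA, rfl⟩).trans hga
  rw [this]
  exact ((hA.inter (hq.isClosed_preimage a)).isCompact.image hp).isClosed

/-- Measurable selection of minimizers: a lower semicontinuous cost on a compact metric space
fibred over `X` has a Borel section of pointwise minimizers. -/
theorem exists_measurable_section_isMin [MeasurableSpace X] [BorelSpace X] {Γ : Type*}
    [MetricSpace Γ] [CompactSpace Γ] [MeasurableSpace Γ] [BorelSpace Γ] [Nonempty Γ]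
    {p : Γ → X} (hp : Continuous p) (hsurj : Function.Surjective p) {q : Γ → ℝ≥0∞}
    (hq : LowerSemicontinuous q) :
    ∃ σ : X → Γ, Measurable σ ∧ (∀ x, p (σ x) = x) ∧ (∀ g, q (σ (p g)) ≤ q g) ∧
      LowerSemicontinuous fun x => q (σ x) := by
  obtain ⟨c₀, hc₀, hc₀s⟩ := exists_nat_bool_continuous_surjective_of_compact Γ
  have hK : CompactSpace cantorSet := isCompact_iff_compactSpace.mp isCompact_cantorSet
  let c : cantorSet → Γ := c₀ ∘ cantorSetHomeomorphNatToBool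
  have hc : Continuous c := hc₀.comp cantorSetHomeomorphNatToBool.continuous
  have hcs : Function.Surjective c := hc₀s.comp cantorSetHomeomorphNatToBool.surjective
  let V : X → ℝ≥0∞ := fun x => ⨅ g ∈ univ ∩ p ⁻¹' {x}, q g
  have hV : LowerSemicontinuous V := lowerSemicontinuous_iInf_fibre hp hq isClosed_univ
  have hVle : ∀ g, V (p g) ≤ q g := fun g => iInf₂_le g ⟨mem_univ _, rfl⟩
  let F : X → Set cantorSet := fun x => (p ∘ c) ⁻¹' {x} ∩ (q ∘ c) ⁻¹' Iic (V x)
  have hqc : LowerSemicontinuous (q ∘ c) := hq.comp hc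
  have hFK : ∀ x, IsCompact (F x) := fun x =>
    ((isClosed_singleton.preimage (hp.comp hc)).inter (hqc.isClosed_preimage _)).isCompact
  have hFne : ∀ x, (F x).Nonempty := by
    intro x
    have hfc : IsCompact (univ ∩ p ⁻¹' {x}) :=
      (isClosed_univ.inter (isClosed_singleton.preimage hp)).isCompact
    obtain ⟨g₀, hg₀⟩ := hsurj x
    have hfne : (univ ∩ p ⁻¹' {x}).Nonempty := ⟨g₀, mem_univ _, hg₀⟩
    obtain ⟨g, hg, hmin⟩ := (hq.lowerSemicontinuousOn _).exists_isMinOn hfne hfc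
    obtain ⟨z, rfl⟩ := hcs g
    have hz : q (c z) ≤ V x := le_iInf₂ fun g' hg' => hmin hg'
    exact ⟨z, hg.2, hz⟩
  choose κ hκF hκmin using fun x =>
    (hFK x).exists_isMinOn (hFne x) (continuous_subtype_val.continuousOn (s := F x))
  have hκm : Measurable κ := by
    have hemb : MeasurableEmbedding (Subtype.val : cantorSet → ℝ) :=
      MeasurableEmbedding.subtype_coe isClosed_cantorSet.measurableSet
    refine hemb.measurable_comp_iff.mp (measurable_of_Iic fun a => ?_)
    let A : Set cantorSet := Subtype.val ⁻¹' Iic a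
    have hA : IsClosed A := isClosed_Iic.preimage continuous_subtype_val
    let VA : X → ℝ≥0∞ := fun x => ⨅ z ∈ A ∩ (p ∘ c) ⁻¹' {x}, (q ∘ c) z
    have hVA : LowerSemicontinuous VA := lowerSemicontinuous_iInf_fibre (hp.comp hc) hqc hA
    have : (Subtype.val ∘ κ) ⁻¹' Iic a = (p ∘ c) '' A ∩ {x | VA x ≤ V x} := by
      ext x
      constructor
      · intro h
        have hVA : VA x ≤ q (c (κ x)) := iInf₂_le (κ x) ⟨h, (hκF x).1⟩
        exact ⟨⟨κ x, h, (hκF x).1⟩, hVA.trans (hκF x).2⟩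
      · rintro ⟨⟨z₀, hz₀, hz₀x⟩, hle⟩
        have hAne : (A ∩ (p ∘ c) ⁻¹' {x}).Nonempty := ⟨z₀, hz₀, hz₀x⟩
        obtain ⟨z, hz, hmin⟩ := (hqc.lowerSemicontinuousOn _).exists_isMinOn hAne
          (hA.inter (isClosed_singleton.preimage (hp.comp hc))).isCompact
        have hzV : q (c z) ≤ VA x := le_iInf₂ fun z' hz' => hmin hz'
        have hzF : z ∈ F x := ⟨hz.2, hzV.trans hle⟩
        have hκz : (κ x : ℝ) ≤ z := hκmin x hzF
        exact hκz.trans hz.1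
    rw [this]
    exact ((hA.isCompact.image (hp.comp hc)).isClosed.measurableSet).inter
      (measurableSet_le hVA.measurable hV.measurable)
  have hσV : ∀ x, q (c (κ x)) = V x := fun x =>
    le_antisymm (hκF x).2 ((congrArg V (hκF x).1).symm.trans_le (hVle (c (κ x))))
  refine ⟨c ∘ κ, hc.measurable.comp hκm, fun x => (hκF x).1, fun g => ?_, ?_⟩
  · exact (hκF (p g)).2.trans (hVle g)
  · simpa only [Function.comp, hσV] using hV

end Selection

section DynamicProgramming

open ProbabilityTheory

variable {X Γ : Type*} [MeasurableSpace X] [MeasurableSpace Γ]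

/-- The `t`-step transition kernel of the time inhomogeneous Markov chain with one step
kernels `κ 0, κ 1, …`. -/
def stepKernel : ℕ → (ℕ → Kernel X X) → Kernel X X
  | 0, _ => Kernel.id
  | t + 1, κ => stepKernel t (fun j => κ (j + 1)) ∘ₖ κ 0

instance isMarkovKernel_stepKernel (t : ℕ) (κ : ℕ → Kernel X X) [h : ∀ j, IsMarkovKernel (κ j)] :
    IsMarkovKernel (stepKernel t κ) := by
  induction t generalizing κ with
  | zero => unfold stepKernel; infer_instance
  | succ t ih =>
    have := ih (fun j => κ (j + 1))
    unfold stepKernel; infer_instance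

theorem stepKernel_succ_eq_comp (t : ℕ) (κ : ℕ → Kernel X X) :
    stepKernel (t + 1) κ = κ t ∘ₖ stepKernel t κ := by
  induction t generalizing κ with
  | zero => simp [stepKernel]
  | succ t ih =>
    rw [stepKernel, ih, Kernel.comp_assoc]
    rfl

/-- The one step state kernels of the policy `τ`. -/
def policyKernel (P : Kernel Γ X) (τ : ℕ → X → Γ) (hτ : ∀ t, Measurable (τ t)) (t : ℕ) :
    Kernel X X := P.comap (τ t) (hτ t)

instance (P : Kernel Γ X) [IsMarkovKernel P] (τ : ℕ → X → Γ) (hτ : ∀ t, Measurable (τ t)) (t : ℕ) :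
    IsMarkovKernel (policyKernel P τ hτ t) := by
  unfold policyKernel; infer_instance

/-- First step decomposition of the total cost of a policy. -/
theorem sum_lintegral_stepKernel_succ (P : Kernel Γ X) (τ : ℕ → X → Γ)
    (hτ : ∀ t, Measurable (τ t)) {l : Γ → ℝ≥0∞} (hl : Measurable l) (b : ℝ≥0∞) (T : ℕ) (x : X) :
    ∑ t ∈ Finset.range (T + 1),
        b ^ t * ∫⁻ z, l (τ t z) ∂stepKernel t (policyKernel P τ hτ) x =
      l (τ 0 x) + b * ∫⁻ y, ∑ t ∈ Finset.range T, b ^ t * ∫⁻ z, l (τ (t + 1) z)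
        ∂stepKernel t (policyKernel P (fun j => τ (j + 1)) fun j => hτ (j + 1)) y ∂P (τ 0 x) := by
  have hm : ∀ t, Measurable fun y => ∫⁻ z, l (τ (t + 1) z)
      ∂stepKernel t (policyKernel P (fun j => τ (j + 1)) fun j => hτ (j + 1)) y :=
    fun t => (hl.comp (hτ (t + 1))).lintegral_kernel
  rw [Finset.sum_range_succ', lintegral_finsetSum _ fun t _ => (hm t).const_mul _, Finset.mul_sum,
    add_comm]
  congr 1
  · simpa [stepKernel, Kernel.id_apply] using lintegral_dirac' x (hl.comp (hτ 0))
  · refine Finset.sum_congr rfl fun t _ => ?_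
    have h := Kernel.lintegral_comp (stepKernel t fun j => policyKernel P τ hτ (j + 1))
      (policyKernel P τ hτ 0) x (hl.comp (hτ (t + 1)))
    simp only [Function.comp_apply] at h
    rw [stepKernel, h, lintegral_const_mul _ (hm t), pow_succ', mul_assoc]
    rfl

/-- The value iteration of the Markov decision problem with running cost `l` and discount
factor `b`: value functions `W T` with `T` remaining steps, and optimal feedbacks `σ T`. -/
theorem exists_valueIteration [TopologicalSpace X] [T2Space X] [BorelSpace X]
    [MetricSpace Γ] [CompactSpace Γ] [BorelSpace Γ] [Nonempty Γ]
    {p : Γ → X} (hp : Continuous p) (hsurj : Function.Surjective p) (P : Kernel Γ X)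
    (hP : ∀ W : X → ℝ≥0∞, LowerSemicontinuous W → LowerSemicontinuous fun g => ∫⁻ x, W x ∂P g)
    {l : Γ → ℝ≥0∞} (hl : LowerSemicontinuous l) {b : ℝ≥0∞} (hb : b ≠ ∞) :
    ∃ (W : ℕ → X → ℝ≥0∞) (τ : ℕ → ℕ → X → Γ) (hτ : ∀ T t, Measurable (τ T t)),
      (∀ T t x, p (τ T t x) = x) ∧ (∀ T, Measurable (W T)) ∧ (∀ x, W 0 x = 0) ∧
      (∀ T g, W (T + 1) (p g) ≤ l g + b * ∫⁻ x, W T x ∂P g) ∧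
      ∀ T x, ∑ t ∈ Finset.range T,
        b ^ t * ∫⁻ z, l (τ T t z) ∂stepKernel t (policyKernel P (τ T) (hτ T)) x = W T x := by
  have hq : ∀ W : {W : X → ℝ≥0∞ // LowerSemicontinuous W},
      LowerSemicontinuous fun g => l g + b * ∫⁻ x, W.1 x ∂P g := fun W =>
    hl.add ((ENNReal.continuous_const_mul hb).comp_lowerSemicontinuous (hP W.1 W.2)
      fun _ _ h => mul_le_mul_right h b)
  choose s hsm hsp hsle hslsc using fun W => exists_measurable_section_isMin hp hsurj (hq W)
  let W : ℕ → {W : X → ℝ≥0∞ // LowerSemicontinuous W} := fun T =>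
    Nat.rec ⟨fun _ => 0, lowerSemicontinuous_const⟩ (fun _ W => ⟨_, hslsc W⟩) T
  let τ : ℕ → ℕ → X → Γ := fun T t => s (W (T - 1 - t))
  have hτ : ∀ T t, Measurable (τ T t) := fun T t => hsm _
  refine ⟨fun T => (W T).1, τ, hτ, fun T t x => hsp _ x, fun T => (W T).2.measurable,
    fun x => rfl, fun T g => hsle (W T) g, fun T => ?_⟩
  induction T with
  | zero => intro x; simp [W]
  | succ T ih =>
    intro x
    rw [sum_lintegral_stepKernel_succ P (τ (T + 1)) (hτ (T + 1)) hl.measurable]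
    have hsh : (fun j => τ (T + 1) (j + 1)) = τ T := by
      funext j
      simp only [τ]
      congr 2
      omega
    have : ∀ y, ∑ t ∈ Finset.range T, b ^ t * ∫⁻ z, l (τ (T + 1) (t + 1) z)
        ∂stepKernel t (policyKernel P (fun j => τ (T + 1) (j + 1)) fun j => hτ (T + 1) (j + 1)) y
        = (W T).1 y := by
      intro y
      refine Eq.trans ?_ (ih y)
      have hker : policyKernel P (fun j => τ (T + 1) (j + 1)) (fun j => hτ (T + 1) (j + 1)) =
          policyKernel P (τ T) (hτ T) := by congr 1
      simp only [hker, fun t => (congrFun hsh t : τ (T + 1) (t + 1) = τ T t)]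
    simp only [this]
    rfl

/-- Integrating the dynamic programming inequality against a stationary measure. -/
theorem sum_lintegral_value_le {p : Γ → X} (hp : Measurable p) (P : Kernel Γ X)
    {l : Γ → ℝ≥0∞} {b c : ℝ≥0∞} {W : ℕ → X → ℝ≥0∞} (hWm : ∀ T, Measurable (W T))
    (hW0 : ∀ x, W 0 x = 0) (hW : ∀ T g, W (T + 1) (p g) ≤ l g + b * ∫⁻ x, W T x ∂P g)
    {γ : Measure Γ} {ν₀ : Measure X} (hγ : γ.map p = b • γ.bind P + c • ν₀) (T : ℕ) :
    ∫⁻ g, W T (p g) ∂γ + c * ∑ t ∈ Finset.range T, ∫⁻ x, W t x ∂ν₀ ≤ T * ∫⁻ g, l g ∂γ := by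
  have key : ∀ t, b * ∫⁻ g, ∫⁻ x, W t x ∂P g ∂γ + c * ∫⁻ x, W t x ∂ν₀ = ∫⁻ g, W t (p g) ∂γ := by
    intro t
    rw [← lintegral_map (hWm t) hp, hγ, lintegral_add_measure, lintegral_smul_measure,
      lintegral_smul_measure, Measure.lintegral_bind P.measurable.aemeasurable
      (hWm t).aemeasurable]
    rfl
  induction T with
  | zero => simp [hW0]
  | succ T ih =>
    calc ∫⁻ g, W (T + 1) (p g) ∂γ + c * ∑ t ∈ Finset.range (T + 1), ∫⁻ x, W t x ∂ν₀
        ≤ (∫⁻ g, (l g + b * ∫⁻ x, W T x ∂P g) ∂γ)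
            + c * ∑ t ∈ Finset.range (T + 1), ∫⁻ x, W t x ∂ν₀ := by
          gcongr with g
          exact hW T g
      _ = ∫⁻ g, l g ∂γ + (b * ∫⁻ g, ∫⁻ x, W T x ∂P g ∂γ + c * ∫⁻ x, W T x ∂ν₀)
            + c * ∑ t ∈ Finset.range T, ∫⁻ x, W t x ∂ν₀ := by
          have hm : Measurable fun g => ∫⁻ x, W T x ∂P g := (hWm T).lintegral_kernel
          rw [lintegral_add_right _ (hm.const_mul b), lintegral_const_mul _ hm,
            Finset.sum_range_succ]
          ring
      _ = ∫⁻ g, l g ∂γ + (∫⁻ g, W T (p g) ∂γ + c * ∑ t ∈ Finset.range T, ∫⁻ x, W t x ∂ν₀) := by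
          rw [key]; ring
      _ ≤ ∫⁻ g, l g ∂γ + T * ∫⁻ g, l g ∂γ := by gcongr
      _ = (T + 1 : ℕ) * ∫⁻ g, l g ∂γ := by push_cast; ring

end DynamicProgramming

section Costs

open ProbabilityTheory

variable {X Γ : Type*} [MeasurableSpace X] [MeasurableSpace Γ]

/-- The expected cost at time `t` under the policy `τ`. -/
def stepCost (P : Kernel Γ X) (k : Γ → ℝ) (τ : ℕ → X → Γ) (hτ : ∀ t, Measurable (τ t)) (t : ℕ)
    (x : X) : ℝ :=
  ∫ z, k (τ t z) ∂stepKernel t (policyKernel P τ hτ) x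

variable (P : Kernel Γ X) [IsMarkovKernel P] {k : Γ → ℝ} {C : ℝ} (hkC : ∀ g, |k g| ≤ C)
  (τ : ℕ → X → Γ) (hτ : ∀ t, Measurable (τ t))

include hkC in
theorem abs_stepCost_le (t : ℕ) (x : X) : |stepCost P k τ hτ t x| ≤ C := by
  have := norm_integral_le_of_norm_le_const (μ := stepKernel t (policyKernel P τ hτ) x)
    (f := fun z => k (τ t z)) (C := C) (Eventually.of_forall fun z => hkC _)
  simpa [stepCost] using this

include hkC in
theorem abs_pow_mul_stepCost_le {b : ℝ} (hb : 0 ≤ b) (t : ℕ) (x : X) :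
    |b ^ t * stepCost P k τ hτ t x| ≤ C * b ^ t := by
  rw [abs_mul, abs_of_nonneg (pow_nonneg hb t), mul_comm]
  exact mul_le_mul_of_nonneg_right (abs_stepCost_le P hkC τ hτ t x) (pow_nonneg hb t)

include hkC in
theorem summable_pow_mul_stepCost {b : ℝ} (hb : 0 ≤ b) (hb1 : b < 1) (x : X) :
    Summable fun t => b ^ t * stepCost P k τ hτ t x :=
  Summable.of_norm_bounded ((summable_geometric_of_lt_one hb hb1).mul_left C)
    fun t => abs_pow_mul_stepCost_le P hkC τ hτ hb t x

include hkC in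
/-- The discounted cost of a policy is within `C (1 - ε) ^ T` of its `T`-step truncation. -/
theorem tsum_pow_mul_stepCost_le {ε : ℝ} (hε : 0 < ε) (hε1 : ε < 1) (T : ℕ) (x : X) :
    ε * ∑' t, (1 - ε) ^ t * stepCost P k τ hτ t x ≤
      ε * ∑ t ∈ Finset.range T, (1 - ε) ^ t * stepCost P k τ hτ t x + C * (1 - ε) ^ T := by
  have hb : 0 ≤ 1 - ε := by linarith
  have hb1 : 1 - ε < 1 := by linarith
  have hs := summable_pow_mul_stepCost P hkC τ hτ hb hb1 x
  rw [← hs.sum_add_tsum_nat_add T, mul_add]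
  have hle : ∑' t, (1 - ε) ^ (t + T) * stepCost P k τ hτ (t + T) x ≤
      ∑' t : ℕ, C * (1 - ε) ^ T * (1 - ε) ^ t := by
    refine Summable.tsum_le_tsum (fun t => ?_) ((summable_nat_add_iff T).mpr hs)
      ((summable_geometric_of_lt_one hb hb1).mul_left _)
    refine (le_abs_self _).trans ((abs_pow_mul_stepCost_le P hkC τ hτ hb _ x).trans_eq ?_)
    ring
  rw [tsum_mul_left, tsum_geometric_of_lt_one hb hb1, sub_sub_cancel] at hle
  have := mul_le_mul_of_nonneg_left hle hε.le
  have h2 : ε * (C * (1 - ε) ^ T * ε⁻¹) = C * (1 - ε) ^ T := by field_simp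
  linarith

end Costs

section Stationary

open ProbabilityTheory

variable {X Γ : Type*} [MetricSpace X] [CompactSpace X] [MeasurableSpace X] [BorelSpace X]
  [MetricSpace Γ] [CompactSpace Γ] [MeasurableSpace Γ] [BorelSpace Γ]

/-- A continuous function on a compact space is integrable against every finite measure. -/
theorem integrable_of_continuous_of_compactSpace {f : Γ → ℝ} (hf : Continuous f) (γ : Measure Γ)
    [IsFiniteMeasure γ] : Integrable f γ :=
  hf.integrable_of_hasCompactSupport (HasCompactSupport.of_compactSpace f)

/-- A continuous composed with a measurable function on a compact space is integrable. -/
theorem integrable_comp_of_compactSpace {Ω : Type*} [MeasurableSpace Ω] {f : Γ → ℝ}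
    (hf : Continuous f) {h : Ω → Γ} (hh : Measurable h) (μ : Measure Ω) [IsFiniteMeasure μ] :
    Integrable (fun ω => f (h ω)) μ :=
  (integrable_of_continuous_of_compactSpace hf (μ.map h)).comp_measurable hh

omit [MetricSpace Γ] [CompactSpace Γ] [BorelSpace Γ] in
theorem integral_bind_of_continuous (P : Kernel Γ X) [IsMarkovKernel P] {φ : X → ℝ}
    (hφ : Continuous φ) (γ : Measure Γ) [IsProbabilityMeasure γ] :
    ∫ x, φ x ∂γ.bind P = ∫ g, ∫ x, φ x ∂P g ∂γ := by
  have h := Kernel.integral_comp (κ := Kernel.const Unit γ) (η := P) (a := ()) (f := φ)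
    (integrable_of_continuous_of_compactSpace hφ _)
  simpa [Kernel.comp_apply] using h

/-- The balance equation of a (discounted) stationary measure, tested against continuous
functions, is an identity between measures. -/
theorem map_eq_iff_forall_integral {p : Γ → X} (hp : Continuous p) (P : Kernel Γ X)
    [IsMarkovKernel P] (hPc : ∀ φ : X → ℝ, Continuous φ → Continuous fun g => ∫ x, φ x ∂P g)
    (γ : Measure Γ) [IsProbabilityMeasure γ] (ν₀ : Measure X) [IsProbabilityMeasure ν₀]
    {ε : ℝ} (hε : 0 ≤ ε) (hε1 : ε ≤ 1) :
    γ.map p = ENNReal.ofReal (1 - ε) • γ.bind P + ENNReal.ofReal ε • ν₀ ↔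
      ∀ φ : X → ℝ, Continuous φ →
        ∫ g, ((1 - ε) * (∫ x, φ x ∂P g - φ (p g)) + ε * (∫ x, φ x ∂ν₀ - φ (p g))) ∂γ = 0 := by
  have hε' : 0 ≤ 1 - ε := by linarith
  have key : ∀ φ : X → ℝ, Continuous φ →
      ∫ g, ((1 - ε) * (∫ x, φ x ∂P g - φ (p g)) + ε * (∫ x, φ x ∂ν₀ - φ (p g))) ∂γ =
        ∫ x, φ x ∂(ENNReal.ofReal (1 - ε) • γ.bind P + ENNReal.ofReal ε • ν₀)
          - ∫ x, φ x ∂γ.map p := by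
    intro φ hφ
    have i1 := integrable_of_continuous_of_compactSpace (hPc φ hφ) γ
    have i2 := integrable_of_continuous_of_compactSpace (hφ.comp hp) γ
    have j1 := integrable_of_continuous_of_compactSpace hφ (γ.bind P)
    have j2 := integrable_of_continuous_of_compactSpace hφ ν₀
    rw [integral_add_measure (j1.smul_measure ENNReal.ofReal_ne_top)
      (j2.smul_measure ENNReal.ofReal_ne_top), integral_smul_measure, integral_smul_measure,
      integral_bind_of_continuous P hφ, integral_map hp.measurable.aemeasurable
      hφ.aestronglyMeasurable, ENNReal.toReal_ofReal hε, ENNReal.toReal_ofReal hε']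
    have : ∀ g, (1 - ε) * (∫ x, φ x ∂P g - φ (p g)) + ε * (∫ x, φ x ∂ν₀ - φ (p g)) =
        (1 - ε) * ∫ x, φ x ∂P g + ε * ∫ x, φ x ∂ν₀ - φ (p g) := fun g => by ring
    simp only [this]
    have i3 : Integrable (fun g => (1 - ε) * ∫ x, φ x ∂P g + ε * ∫ x, φ x ∂ν₀) γ :=
      (i1.const_mul _).add (integrable_const _)
    have i4 : Integrable (fun g => φ (p g)) γ := i2
    rw [integral_sub i3 i4, integral_add (i1.const_mul _) (integrable_const _), integral_const_mul]
    simp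
  constructor
  · intro h φ hφ
    rw [key φ hφ, h, sub_self]
  · intro h
    have : IsFiniteMeasure (ENNReal.ofReal (1 - ε) • γ.bind P + ENNReal.ofReal ε • ν₀) := by
      have := Measure.smul_finite (γ.bind P) (ENNReal.ofReal_ne_top (r := 1 - ε))
      have := Measure.smul_finite ν₀ (ENNReal.ofReal_ne_top (r := ε))
      infer_instance
    refine ext_of_forall_integral_eq_of_IsFiniteMeasure fun φ => ?_
    have := h φ φ.continuous
    rw [key φ φ.continuous] at this
    linarith

section CostTransforms

variable (P : Kernel Γ X) [IsMarkovKernel P] {k : Γ → ℝ} (hk : Continuous k) {C : ℝ}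
  (hkC : ∀ g, |k g| ≤ C) (τ : ℕ → X → Γ) (hτ : ∀ t, Measurable (τ t))

include hk hkC in
theorem lintegral_ofReal_add_eq {Ω : Type*} [MeasurableSpace Ω] {h : Ω → Γ} (hh : Measurable h)
    (μ : Measure Ω) [IsProbabilityMeasure μ] :
    ∫⁻ ω, ENNReal.ofReal (k (h ω) + C) ∂μ = ENNReal.ofReal (∫ ω, k (h ω) ∂μ + C) := by
  have hi := integrable_comp_of_compactSpace hk hh μ
  have hi' : Integrable (fun ω => k (h ω) + C) μ := hi.add (integrable_const C)
  rw [← ofReal_integral_eq_lintegral_ofReal hi'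
    (Eventually.of_forall fun ω => by
      have := abs_le.mp (hkC (h ω))
      simp only [Pi.zero_apply]
      linarith),
    integral_add hi (integrable_const C)]
  simp

omit [MetricSpace X] [CompactSpace X] [BorelSpace X] in
include hk hkC in
theorem sum_lintegral_ofReal_eq {b : ℝ} (hb : 0 ≤ b) (T : ℕ) (x : X) :
    ∑ t ∈ Finset.range T, ENNReal.ofReal b ^ t * ∫⁻ z, ENNReal.ofReal (k (τ t z) + C)
        ∂stepKernel t (policyKernel P τ hτ) x =
      ENNReal.ofReal (∑ t ∈ Finset.range T, b ^ t * (stepCost P k τ hτ t x + C)) := by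
  have hn : ∀ t, 0 ≤ stepCost P k τ hτ t x + C := fun t => by
    have := abs_le.mp (abs_stepCost_le P hkC τ hτ t x); linarith
  rw [ENNReal.ofReal_sum_of_nonneg fun t _ => mul_nonneg (pow_nonneg hb t) (hn t)]
  refine Finset.sum_congr rfl fun t _ => ?_
  rw [lintegral_ofReal_add_eq hk hkC (hτ t), ENNReal.ofReal_mul (pow_nonneg hb t),
    ENNReal.ofReal_pow hb]
  rfl

end CostTransforms

variable [Nonempty Γ] {p : Γ → X} (hp : Continuous p) (hsurj : Function.Surjective p)
  (P : Kernel Γ X) [IsMarkovKernel P]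
  (hP : ∀ W : X → ℝ≥0∞, LowerSemicontinuous W → LowerSemicontinuous fun g => ∫⁻ x, W x ∂P g)
  {k : Γ → ℝ} (hk : Continuous k) {C : ℝ} (hkC : ∀ g, |k g| ≤ C)

include hp hsurj hP hk hkC

omit [CompactSpace X] in
/-- A lower bound for all finite horizon costs is a lower bound for the stationary costs. -/
theorem mul_le_mul_integral_of_map_eq {γ : Measure Γ} [IsProbabilityMeasure γ]
    (hγ : γ.map p = γ.bind P) (T : ℕ) {m : ℝ}
    (hm : ∀ (τ : ℕ → X → Γ) (hτ : ∀ t, Measurable (τ t)), (∀ t x, p (τ t x) = x) → ∀ x,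
      T * m ≤ ∑ t ∈ Finset.range T, stepCost P k τ hτ t x) :
    T * m ≤ T * ∫ g, k g ∂γ := by
  have hl : Continuous fun g => ENNReal.ofReal (k g + C) :=
    ENNReal.continuous_ofReal.comp (hk.add continuous_const)
  obtain ⟨W, τ, hτ, hτp, hWm, hW0, hW, hWτ⟩ := exists_valueIteration hp hsurj P hP
    hl.lowerSemicontinuous (ENNReal.ofReal_ne_top (r := 1))
  have h1 := sum_lintegral_value_le hp.measurable P hWm hW0 hW (c := 0) (ν₀ := γ.map p)
    (by simpa using hγ) T
  have h2 : ∀ x, ENNReal.ofReal (T * (m + C)) ≤ W T x := by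
    intro x
    rw [← hWτ, sum_lintegral_ofReal_eq P hk hkC (τ T) (hτ T) zero_le_one]
    refine ENNReal.ofReal_le_ofReal ?_
    have := hm (τ T) (hτ T) (hτp T) x
    simp only [one_pow, one_mul, Finset.sum_add_distrib, Finset.sum_const, Finset.card_range,
      nsmul_eq_mul]
    linarith
  have hIC : 0 ≤ ∫ g, k g ∂γ + C := by
    have : |∫ g, k g ∂γ| ≤ C := by
      simpa using norm_integral_le_of_norm_le_const (μ := γ) (f := k) (Eventually.of_forall hkC)
    have := abs_le.mp this
    linarith
  have h3 : ENNReal.ofReal (T * (m + C)) ≤ ENNReal.ofReal (T * (∫ g, k g ∂γ + C)) := by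
    calc ENNReal.ofReal (T * (m + C)) = ∫⁻ _, ENNReal.ofReal (T * (m + C)) ∂γ := by simp
      _ ≤ ∫⁻ g, W T (p g) ∂γ := lintegral_mono fun g => h2 (p g)
      _ ≤ T * ∫⁻ g, ENNReal.ofReal (k g + C) ∂γ := by simpa using h1
      _ = _ := by
        rw [lintegral_ofReal_add_eq hk hkC (h := fun g => g) measurable_id γ,
            ENNReal.ofReal_mul (by positivity), ENNReal.ofReal_natCast]
  rw [ENNReal.ofReal_le_ofReal_iff (by positivity)] at h3
  linarith

omit [CompactSpace X] in
/-- A lower bound for all discounted costs is a lower bound for the costs of the discounted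
stationary measures. -/
theorem le_integral_of_map_eq {ε : ℝ} (hε : 0 < ε) (hε1 : ε < 1) {γ : Measure Γ}
    [IsProbabilityMeasure γ] {ν₀ : Measure X} [IsProbabilityMeasure ν₀]
    (hγ : γ.map p = ENNReal.ofReal (1 - ε) • γ.bind P + ENNReal.ofReal ε • ν₀) {m : ℝ}
    (hm : ∀ (τ : ℕ → X → Γ) (hτ : ∀ t, Measurable (τ t)), (∀ t x, p (τ t x) = x) →
      ∀ᵐ x ∂ν₀, m ≤ ε * ∑' t, (1 - ε) ^ t * stepCost P k τ hτ t x) :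
    m ≤ ∫ g, k g ∂γ := by
  have hb : 0 ≤ 1 - ε := by linarith
  have hb1 : 1 - ε < 1 := by linarith
  have hC : 0 ≤ C := (abs_nonneg _).trans (hkC (Classical.arbitrary Γ))
  have hl : Continuous fun g => ENNReal.ofReal (k g + C) :=
    ENNReal.continuous_ofReal.comp (hk.add continuous_const)
  obtain ⟨W, τ, hτ, hτp, hWm, hW0, hW, hWτ⟩ := exists_valueIteration hp hsurj P hP
    hl.lowerSemicontinuous (ENNReal.ofReal_ne_top (r := 1 - ε))
  have hIC : 0 ≤ ∫ g, k g ∂γ + C := by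
    have : |∫ g, k g ∂γ| ≤ C := by
      simpa using norm_integral_le_of_norm_le_const (μ := γ) (f := k) (Eventually.of_forall hkC)
    have := abs_le.mp this
    linarith
  have h2 : ∀ T, ENNReal.ofReal ((m + C) - 2 * C * (1 - ε) ^ T) ≤
      ENNReal.ofReal ε * ∫⁻ x, W T x ∂ν₀ := by
    intro T
    rw [← lintegral_const_mul _ (hWm T)]
    calc ENNReal.ofReal ((m + C) - 2 * C * (1 - ε) ^ T)
        = ∫⁻ _, ENNReal.ofReal ((m + C) - 2 * C * (1 - ε) ^ T) ∂ν₀ := by simp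
      _ ≤ _ := by
        refine lintegral_mono_ae ((hm (τ T) (hτ T) (hτp T)).mono fun x hx => ?_)
        rw [← hWτ, sum_lintegral_ofReal_eq P hk hkC (τ T) (hτ T) hb, ← ENNReal.ofReal_mul hε.le]
        refine ENNReal.ofReal_le_ofReal ?_
        have h3 := tsum_pow_mul_stepCost_le P hkC (τ T) (hτ T) hε hε1 T x
        have h4 : ε * ∑ t ∈ Finset.range T, (1 - ε) ^ t * C = C * (1 - (1 - ε) ^ T) := by
          rw [← Finset.sum_mul, geom_sum_eq (by linarith)]
          have : (1 - ε - 1) ≠ 0 := by linarith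
          field_simp
          ring
        simp only [mul_add, Finset.sum_add_distrib]
        linarith
  have h5 : ∀ T : ℕ, T * (m - ∫ g, k g ∂γ) ≤ 2 * C * ε⁻¹ := by
    intro T
    have h1 := sum_lintegral_value_le hp.measurable P hWm hW0 hW hγ T
    have h6 : ENNReal.ofReal (∑ t ∈ Finset.range T, ((m + C) - 2 * C * (1 - ε) ^ t)) ≤
        ENNReal.ofReal (T * (∫ g, k g ∂γ + C)) := by
      calc _ ≤ ∑ t ∈ Finset.range T, ENNReal.ofReal ((m + C) - 2 * C * (1 - ε) ^ t) :=
            Finset.le_sum_of_subadditive _ (by simp) (fun _ _ => ENNReal.ofReal_add_le) _ _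
        _ ≤ ∑ t ∈ Finset.range T, ENNReal.ofReal ε * ∫⁻ x, W t x ∂ν₀ :=
            Finset.sum_le_sum fun t _ => h2 t
        _ ≤ T * ∫⁻ g, ENNReal.ofReal (k g + C) ∂γ := by
            rw [← Finset.mul_sum]
            exact le_add_self.trans h1
        _ = _ := by
            rw [lintegral_ofReal_add_eq hk hkC (h := fun g => g) measurable_id γ,
            ENNReal.ofReal_mul (by positivity), ENNReal.ofReal_natCast]
    rw [ENNReal.ofReal_le_ofReal_iff (by positivity)] at h6
    simp only [Finset.sum_sub_distrib, Finset.sum_const, Finset.card_range, nsmul_eq_mul,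
      ← Finset.mul_sum] at h6
    have h7 : ∑ t ∈ Finset.range T, (1 - ε) ^ t ≤ ε⁻¹ := by
      have := (summable_geometric_of_lt_one hb hb1).sum_le_tsum (Finset.range T)
        fun t _ => pow_nonneg hb t
      rwa [tsum_geometric_of_lt_one hb hb1, sub_sub_cancel] at this
    have h8 := mul_le_mul_of_nonneg_left h7 (by positivity : 0 ≤ 2 * C)
    linarith
  by_contra! hlt
  obtain ⟨T, hT⟩ := exists_nat_gt (2 * C * ε⁻¹ / (m - ∫ g, k g ∂γ))
  rw [div_lt_iff₀ (by linarith)] at hT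
  linarith [h5 T]

end Stationary

section Occupation

open ProbabilityTheory

variable {X Γ : Type*} [MetricSpace X] [CompactSpace X] [MeasurableSpace X] [BorelSpace X]
  [MetricSpace Γ] [CompactSpace Γ] [MeasurableSpace Γ] [BorelSpace Γ]

omit [MetricSpace X] [CompactSpace X] [BorelSpace X] in
/-- The occupational measure of a policy with prescribed time weights. -/
theorem exists_occupationMeasure (P : Kernel Γ X) [IsMarkovKernel P] (τ : ℕ → X → Γ)
    (hτ : ∀ t, Measurable (τ t)) (x : X) {w : ℕ → ℝ} (hw : ∀ t, 0 ≤ w t) (hw1 : HasSum w 1) :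
    ∃ γ : ProbabilityMeasure Γ, ∀ f : Γ → ℝ, Continuous f →
      HasSum (fun t => w t * stepCost P f τ hτ t x) (∫ g, f g ∂(γ : Measure Γ)) := by
  let μ : Measure Γ := Measure.sum fun t =>
    ENNReal.ofReal (w t) • (stepKernel t (policyKernel P τ hτ) x).map (τ t)
  have hμ : IsProbabilityMeasure μ := by
    constructor
    have : ∀ t, ((stepKernel t (policyKernel P τ hτ) x).map (τ t)) univ = 1 := fun t => by
      rw [Measure.map_apply (hτ t) MeasurableSet.univ]; simp
    rw [Measure.sum_apply _ MeasurableSet.univ]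
    simp only [Measure.smul_apply, this, smul_eq_mul, mul_one]
    rw [← ENNReal.ofReal_tsum_of_nonneg hw hw1.summable, hw1.tsum_eq, ENNReal.ofReal_one]
  refine ⟨⟨μ, hμ⟩, fun f hf => ?_⟩
  have h := hasSum_integral_measure (μ := fun t =>
    ENNReal.ofReal (w t) • (stepKernel t (policyKernel P τ hτ) x).map (τ t)) (f := f)
    (integrable_of_continuous_of_compactSpace hf μ)
  have hfun : (fun t => ∫ g, f g ∂(ENNReal.ofReal (w t) •
      (stepKernel t (policyKernel P τ hτ) x).map (τ t))) =
        fun t => w t * stepCost P f τ hτ t x := by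
    funext t
    rw [integral_smul_measure, ENNReal.toReal_ofReal (hw t),
      integral_map (hτ t).aemeasurable hf.aestronglyMeasurable]
    rfl
  rw [hfun] at h
  exact h

omit [MetricSpace Γ] [CompactSpace Γ] [BorelSpace Γ] in
theorem stepCost_integral_kernel (P : Kernel Γ X) [IsMarkovKernel P] (τ : ℕ → X → Γ)
    (hτ : ∀ t, Measurable (τ t)) {φ : X → ℝ} (hφ : Continuous φ) (t : ℕ) (x : X) :
    stepCost P (fun g => ∫ y, φ y ∂P g) τ hτ t x =
      ∫ z, φ z ∂stepKernel (t + 1) (policyKernel P τ hτ) x := by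
  rw [stepKernel_succ_eq_comp, Kernel.integral_comp (integrable_of_continuous_of_compactSpace hφ _)]
  rfl

omit [MetricSpace X] [CompactSpace X] [BorelSpace X] [MetricSpace Γ] [CompactSpace Γ]
  [BorelSpace Γ] in
theorem stepCost_comp_of_section (P : Kernel Γ X) {p : Γ → X} (τ : ℕ → X → Γ)
    (hτ : ∀ t, Measurable (τ t)) (hτp : ∀ t x, p (τ t x) = x) (φ : X → ℝ) (t : ℕ) (x : X) :
    stepCost P (fun g => φ (p g)) τ hτ t x = ∫ z, φ z ∂stepKernel t (policyKernel P τ hτ) x := by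
  simp only [stepCost, hτp]

/-- The probability measures satisfying the discounted balance equation. -/
def balanceSet (p : Γ → X) (P : Kernel Γ X) (ε : ℝ) (x₀ : X) : Set (ProbabilityMeasure Γ) :=
  {γ | ∀ φ : X → ℝ, Continuous φ → ∫ g, ((1 - ε) * (∫ x, φ x ∂P g - φ (p g))
    + ε * (φ x₀ - φ (p g))) ∂(γ : Measure Γ) = 0}

variable {p : Γ → X} (hp : Continuous p) (P : Kernel Γ X) [IsMarkovKernel P]
  (hPc : ∀ φ : X → ℝ, Continuous φ → Continuous fun g => ∫ x, φ x ∂P g)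

include hp hPc

omit [CompactSpace X] [BorelSpace X] [IsMarkovKernel P] in
theorem integral_balance {φ : X → ℝ} (hφ : Continuous φ) (ε c : ℝ) (γ : Measure Γ)
    [IsProbabilityMeasure γ] :
    ∫ g, ((1 - ε) * (∫ x, φ x ∂P g - φ (p g)) + ε * (c - φ (p g))) ∂γ =
      (1 - ε) * (∫ g, ∫ x, φ x ∂P g ∂γ - ∫ g, φ (p g) ∂γ) + ε * (c - ∫ g, φ (p g) ∂γ) := by
  have i1 := integrable_of_continuous_of_compactSpace (hPc φ hφ) γ
  have i2 : Integrable (fun g => φ (p g)) γ :=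
    integrable_of_continuous_of_compactSpace (hφ.comp hp) γ
  have i3 : Integrable (fun g => (1 - ε) * (∫ x, φ x ∂P g - φ (p g))) γ := (i1.sub i2).const_mul _
  have i4 : Integrable (fun g => ε * (c - φ (p g))) γ := ((integrable_const c).sub i2).const_mul _
  rw [integral_add i3 i4, integral_const_mul, integral_const_mul, integral_sub i1 i2,
    integral_sub (integrable_const c) i2]
  simp

/-- Discounted occupational measures satisfy the discounted balance equation. -/
theorem exists_discountedOccupation (τ : ℕ → X → Γ) (hτ : ∀ t, Measurable (τ t))
    (hτp : ∀ t x, p (τ t x) = x) {ε : ℝ} (hε : 0 < ε) (hε1 : ε < 1) (x₀ : X) {k : Γ → ℝ}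
    (hk : Continuous k) :
    ∃ γ ∈ balanceSet p P ε x₀,
      ∫ g, k g ∂(γ : Measure Γ) = ε * ∑' t, (1 - ε) ^ t * stepCost P k τ hτ t x₀ := by
  have hb : 0 ≤ 1 - ε := by linarith
  have hw1 : HasSum (fun t : ℕ => ε * (1 - ε) ^ t) 1 := by
    have := (hasSum_geometric_of_lt_one hb (by linarith)).mul_left ε
    rwa [sub_sub_cancel, mul_inv_cancel₀ hε.ne'] at this
  obtain ⟨γ, hγ⟩ := exists_occupationMeasure P τ hτ x₀ (fun t => by positivity) hw1
  refine ⟨γ, fun φ hφ => ?_, ?_⟩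
  · rw [integral_balance hp P hPc hφ]
    have h1 := (hγ _ (hPc φ hφ)).mul_left (1 - ε)
    have h2 := hγ _ (hφ.comp hp)
    have e2 : stepCost P (φ ∘ p) τ hτ = stepCost P (fun g => φ (p g)) τ hτ := rfl
    simp only [stepCost_integral_kernel P τ hτ hφ] at h1
    simp only [e2, stepCost_comp_of_section P τ hτ hτp] at h2
    have h3 := (hasSum_nat_add_iff' 1).mpr h2
    have h4 : HasSum (fun t : ℕ => ε * (1 - ε) ^ (t + 1) *
        ∫ z, φ z ∂stepKernel (t + 1) (policyKernel P τ hτ) x₀)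
        ((1 - ε) * ∫ g, ∫ y, φ y ∂P g ∂(γ : Measure Γ)) := by
      have hfun : (fun t : ℕ => ε * (1 - ε) ^ (t + 1) *
          ∫ z, φ z ∂stepKernel (t + 1) (policyKernel P τ hτ) x₀) = fun t => (1 - ε) *
            (ε * (1 - ε) ^ t * ∫ z, φ z ∂stepKernel (t + 1) (policyKernel P τ hτ) x₀) := by
        funext t
        ring
      rw [hfun]
      exact h1
    have h5 := h3.unique h4
    simp only [Finset.range_one, Finset.sum_singleton, pow_zero, mul_one, stepKernel,
      Kernel.id_apply, integral_dirac, Function.comp_apply] at h5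
    linarith
  · rw [← (hγ k hk).tsum_eq, ← tsum_mul_left]
    simp only [mul_assoc]

/-- Finite horizon occupational measures satisfy the balance equation up to `O(1 / T)`. -/
theorem exists_finiteOccupation (τ : ℕ → X → Γ) (hτ : ∀ t, Measurable (τ t))
    (hτp : ∀ t x, p (τ t x) = x) {T : ℕ} (hT : 0 < T) (x₀ : X) {k : Γ → ℝ}
    (hk : Continuous k) :
    ∃ γ : ProbabilityMeasure Γ, (∀ φ : X → ℝ, Continuous φ → ∀ B : ℝ, (∀ x, |φ x| ≤ B) →
        |∫ g, ∫ x, φ x ∂P g ∂(γ : Measure Γ) - ∫ g, φ (p g) ∂(γ : Measure Γ)| ≤ 2 * B / T) ∧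
      ∫ g, k g ∂(γ : Measure Γ) = (1 / (T : ℝ)) * ∑ t ∈ Finset.range T, stepCost P k τ hτ t x₀ := by
  let w : ℕ → ℝ := fun t => if t ∈ Finset.range T then 1 / (T : ℝ) else 0
  have hsum : ∀ a : ℕ → ℝ,
      HasSum (fun t => w t * a t) (1 / (T : ℝ) * ∑ t ∈ Finset.range T, a t) := by
    intro a
    rw [Finset.mul_sum]
    have : ∑ t ∈ Finset.range T, 1 / (T : ℝ) * a t = ∑ t ∈ Finset.range T, w t * a t :=
      Finset.sum_congr rfl fun t ht => by simp only [w, if_pos ht]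
    rw [this]
    exact hasSum_sum_of_ne_finset_zero fun t ht => by simp only [w, if_neg ht, zero_mul]
  have hw1 : HasSum w 1 := by
    have := hsum fun _ => 1
    have hT' : (T : ℝ) ≠ 0 := by positivity
    simpa [hT'] using this
  obtain ⟨γ, hγ⟩ := exists_occupationMeasure P τ hτ x₀
    (fun t => by simp only [w]; positivity) hw1
  have hint : ∀ f : Γ → ℝ, Continuous f → ∫ g, f g ∂(γ : Measure Γ) =
      1 / (T : ℝ) * ∑ t ∈ Finset.range T, stepCost P f τ hτ t x₀ :=
    fun f hf => (hγ f hf).unique (hsum _)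
  refine ⟨γ, fun φ hφ B hB => ?_, hint k hk⟩
  rw [hint _ (hPc φ hφ), hint (fun g => φ (p g)) (hφ.comp hp), ← mul_sub, ← Finset.sum_sub_distrib]
  simp only [stepCost_integral_kernel P τ hτ hφ, stepCost_comp_of_section P τ hτ hτp]
  rw [Finset.sum_range_sub fun t => ∫ z, φ z ∂stepKernel t (policyKernel P τ hτ) x₀, abs_mul,
    abs_of_nonneg (by positivity), one_div_mul_eq_div]
  have hle : ∀ t, |∫ z, φ z ∂stepKernel t (policyKernel P τ hτ) x₀| ≤ B := fun t => by
    simpa using norm_integral_le_of_norm_le_const (f := φ)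
      (μ := stepKernel t (policyKernel P τ hτ) x₀) (Eventually.of_forall hB)
  gcongr
  refine (abs_sub _ _).trans ?_
  linarith [hle T, hle 0]

omit [CompactSpace X] [BorelSpace X] [IsMarkovKernel P] in
/-- Values squeezed between stationary costs and costs of asymptotically stationary measures
converge to the optimal stationary cost. -/
theorem tendsto_sInf_stationary {ι : Type*} {l : Filter ι} {k : Γ → ℝ} (hk : Continuous k) (x₀ : X)
    {F δ : ι → ℝ} {γ : ι → ProbabilityMeasure Γ} (hδ : Tendsto δ l (𝓝 0))
    (hF : ∀ᶠ i in l, ∫ g, k g ∂(γ i : Measure Γ) ≤ F i + δ i)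
    (hγ : ∀ φ : X → ℝ, Continuous φ → Tendsto (fun i => ∫ g, ∫ x, φ x ∂P g ∂(γ i : Measure Γ)
      - ∫ g, φ (p g) ∂(γ i : Measure Γ)) l (𝓝 0))
    (hup : ∀ᶠ i in l, ∀ γ' ∈ balanceSet p P 0 x₀, F i ≤ ∫ g, k g ∂(γ' : Measure Γ)) :
    Tendsto F l (𝓝 (sInf ((fun γ : ProbabilityMeasure Γ => ∫ g, k g ∂(γ : Measure Γ)) ''
      balanceSet p P 0 x₀))) := by
  rw [tendsto_iff_ultrafilter]
  intro 𝒰 h𝒰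
  obtain ⟨γ', -, hγ'⟩ := isCompact_univ.ultrafilter_le_nhds (𝒰.map γ) (by simp)
  have hlim : ∀ f : Γ → ℝ, Continuous f →
      Tendsto (fun i => ∫ g, f g ∂(γ i : Measure Γ)) 𝒰 (𝓝 (∫ g, f g ∂(γ' : Measure Γ))) := by
    intro f hf
    exact ProbabilityMeasure.tendsto_iff_forall_integral_tendsto.mp
      (show Tendsto γ 𝒰 (𝓝 γ') from hγ') (BoundedContinuousFunction.mkOfCompact ⟨f, hf⟩)
  have hmem : γ' ∈ balanceSet p P 0 x₀ := by
    intro φ hφ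
    rw [integral_balance hp P hPc hφ]
    have := tendsto_nhds_unique ((hlim _ (hPc φ hφ)).sub (hlim _ (hφ.comp hp)))
      ((hγ φ hφ).mono_left h𝒰)
    simp only [Function.comp_apply] at this
    rw [this]
    simp
  set S := (fun γ : ProbabilityMeasure Γ => ∫ g, k g ∂(γ : Measure Γ)) '' balanceSet p P 0 x₀
  have hFS : ∀ᶠ i in (𝒰 : Filter ι), F i ≤ sInf S := by
    filter_upwards [h𝒰 hup] with i hi
    exact le_csInf ⟨_, γ', hmem, rfl⟩ (by rintro _ ⟨γ'', h, rfl⟩; exact hi γ'' h)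
  have hbdd : BddBelow S := by
    obtain ⟨C, hC⟩ := isCompact_univ.exists_bound_of_continuousOn hk.continuousOn
    refine ⟨-C, ?_⟩
    rintro _ ⟨γ'', -, rfl⟩
    have := norm_integral_le_of_norm_le_const (μ := (γ'' : Measure Γ)) (f := k)
      (Eventually.of_forall fun g => hC g (mem_univ g))
    exact (abs_le.mp (by simpa using this)).1
  have hL := (hlim k hk).sub (hδ.mono_left h𝒰)
  rw [sub_zero] at hL
  have hlow : ∀ᶠ i in (𝒰 : Filter ι), ∫ g, k g ∂(γ i : Measure Γ) - δ i ≤ F i := by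
    filter_upwards [h𝒰 hF] with i hi
    linarith
  have hLS : ∫ g, k g ∂(γ' : Measure Γ) = sInf S := by
    refine le_antisymm (le_of_tendsto hL ?_) (csInf_le hbdd ⟨γ', hmem, rfl⟩)
    filter_upwards [hlow, hFS] with i h1 h2
    exact h1.trans h2
  rw [hLS] at hL
  exact tendsto_of_tendsto_of_tendsto_of_le_of_le' hL tendsto_const_nhds hlow hFS

end Occupation

section Concrete

open ProbabilityTheory

variable (M : Model n Uc S)

instance Model.compactSpace_Y : CompactSpace M.Y := isCompact_iff_compactSpace.mp M.Y_compact

instance Model.nonempty_Y : Nonempty M.Y := M.Y_nonempty.to_subtype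

instance Model.isProbabilityMeasure_ν : IsProbabilityMeasure M.ν := M.ν_prob

instance Model.compactSpace_graphG : CompactSpace (graphG M) :=
  isCompact_iff_compactSpace.mp <|
    (M.Y_compact.prod isCompact_univ).of_isClosed_subset M.graph_closed fun _ h => ⟨h.1, mem_univ _⟩

instance Model.nonempty_graphG : Nonempty (graphG M) := by
  obtain ⟨y, hy⟩ := M.Y_nonempty
  obtain ⟨u, hu⟩ := M.U_nonempty y hy
  exact ⟨⟨(y, u), hy, hu⟩⟩

theorem measurableSet_graphG : MeasurableSet (graphG M) :=
  IsClosed.measurableSet M.graph_closed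

theorem measurableSet_Y : MeasurableSet M.Y := M.Y_compact.isClosed.measurableSet

/-- The state component of a point of the graph. -/
def baseState (g : graphG M) : M.Y := ⟨g.1.1, g.2.1⟩

theorem continuous_baseState : Continuous (baseState M) := by
  unfold baseState; fun_prop

theorem surjective_baseState : Function.Surjective (baseState M) := by
  rintro ⟨y, hy⟩
  obtain ⟨u, hu⟩ := M.U_nonempty y hy
  exact ⟨⟨(y, u), hy, hu⟩, rfl⟩

/-- The next state, for a state control pair in the graph and a noise value. -/
def nextState (g : graphG M) (s : S) : M.Y := ⟨M.f g.1.1 g.1.2 s, M.f_inv _ g.2.1 _ g.2.2 s⟩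

theorem continuous_nextState (s : S) : Continuous fun g => nextState M g s := by
  refine Continuous.subtype_mk ?_ _
  exact ((M.f_cont s).comp_continuous continuous_subtype_val fun g => ⟨g.2.1, mem_univ _⟩)

theorem measurable_nextState (g : graphG M) : Measurable (nextState M g) :=
  (M.f_meas _ g.2.1 _).subtype_mk

theorem measurable_uncurry_nextState : Measurable (Function.uncurry (nextState M)) := by
  exact measurable_uncurry_of_continuous_of_measurable (continuous_nextState M)
    (measurable_nextState M)

/-- The transition kernel from state control pairs to states. -/
def transition : Kernel (graphG M) M.Y :=
  (Kernel.id ×ₖ Kernel.const (graphG M) M.ν).map (Function.uncurry (nextState M))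

instance : IsMarkovKernel (transition M) :=
  Kernel.IsMarkovKernel.map _ (measurable_uncurry_nextState M)

theorem transition_apply (g : graphG M) : transition M g = M.ν.map (nextState M g) := by
  rw [transition, Kernel.map_apply _ (measurable_uncurry_nextState M), Kernel.prod_apply,
    Kernel.id_apply, Kernel.const_apply, Measure.dirac_prod,
    Measure.map_map (measurable_uncurry_nextState M) (by fun_prop)]
  rfl

theorem integral_transition {φ : M.Y → ℝ} (hφ : Continuous φ) (g : graphG M) :
    ∫ x, φ x ∂transition M g = ∫ s, φ (nextState M g s) ∂M.ν := by
  rw [transition_apply, integral_map (measurable_nextState M g).aemeasurable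
    hφ.aestronglyMeasurable]

theorem continuous_integral_transition (φ : M.Y → ℝ) (hφ : Continuous φ) :
    Continuous fun g => ∫ x, φ x ∂transition M g := by
  simp only [integral_transition M hφ]
  obtain ⟨B, hB⟩ := isCompact_univ.exists_bound_of_continuousOn hφ.continuousOn
  refine continuous_of_dominated (bound := fun _ => B) (fun g => ?_)
    (fun g => Eventually.of_forall fun s => hB _ (mem_univ _)) (integrable_const B)
    (Eventually.of_forall fun s => hφ.comp (continuous_nextState M s))
  exact (hφ.measurable.comp (measurable_nextState M g)).aestronglyMeasurable

theorem lowerSemicontinuous_lintegral_transition (W : M.Y → ℝ≥0∞) (hW : LowerSemicontinuous W) :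
    LowerSemicontinuous fun g => ∫⁻ x, W x ∂transition M g := by
  have h : ∀ g, ∫⁻ x, W x ∂transition M g = ∫⁻ s, W (nextState M g s) ∂M.ν := fun g => by
    rw [transition_apply, lintegral_map hW.measurable (measurable_nextState M g)]
  simp only [h]
  intro g a ha
  by_contra hcon
  rw [Filter.not_eventually] at hcon
  obtain ⟨u, hu, hua⟩ := exists_seq_forall_of_frequently hcon
  have hle : ∫⁻ s, W (nextState M g s) ∂M.ν ≤
      ∫⁻ s, liminf (fun i => W (nextState M (u i) s)) atTop ∂M.ν := by
    refine lintegral_mono fun s => ?_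
    exact (hW.le_liminf _).trans
      (liminf_le_liminf_of_le (((continuous_nextState M s).tendsto g).comp hu))
  have := hle.trans (lintegral_liminf_le fun i => hW.measurable.comp (measurable_nextState M (u i)))
  have h2 : liminf (fun i => ∫⁻ s, W (nextState M (u i) s) ∂M.ν) atTop ≤ a :=
    liminf_le_of_frequently_le' (Frequently.of_forall fun i => not_lt.mp (hua i))
  exact absurd (this.trans h2) (not_le.mpr ha)
end Concrete

section Plans

open ProbabilityTheory

variable (M : Model n Uc S)

theorem measurableEmbedding_state : MeasurableEmbedding (Subtype.val : M.Y → Fin n → ℝ) :=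
  MeasurableEmbedding.subtype_coe (measurableSet_Y M)

theorem measurableEmbedding_graphG :
    MeasurableEmbedding (Subtype.val : graphG M → (Fin n → ℝ) × Uc) :=
  MeasurableEmbedding.subtype_coe (measurableSet_graphG M)

variable {M}

/-- The control plan obtained by deleting the first decision. -/
def Plan.shift (π : Plan M) : Plan M :=
  ⟨fun t => π.π (t + 1), fun t => π.measurable (t + 1), fun t => π.feasible (t + 1)⟩

/-- The policy on the graph defined by a control plan. -/
def Plan.policy (π : Plan M) (t : ℕ) (x : M.Y) : graphG M :=
  ⟨(x, π.π t x), x.2, π.feasible t x x.2⟩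

theorem Plan.measurable_policy (π : Plan M) (t : ℕ) : Measurable (π.policy t) :=
  (measurable_subtype_coe.prodMk ((π.measurable t).comp measurable_subtype_coe)).subtype_mk

theorem Plan.baseState_policy (π : Plan M) (t : ℕ) (x : M.Y) :
    baseState M (π.policy t x) = x := rfl

/-- Every measurable policy on the graph is the policy of a control plan. -/
theorem exists_plan_policy_eq (τ : ℕ → M.Y → graphG M) (hτ : ∀ t, Measurable (τ t))
    (hτp : ∀ t x, baseState M (τ t x) = x) : ∃ π : Plan M, π.policy = τ := by
  classical
  let u₀ : Uc := (Classical.arbitrary (graphG M)).1.2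
  refine ⟨⟨fun t y => if hy : y ∈ M.Y then (τ t ⟨y, hy⟩).1.2 else u₀, fun t => ?_,
    fun t y hy => ?_⟩, ?_⟩
  · exact Measurable.dite (s := M.Y) (f := fun x => (τ t x).1.2) (g := fun _ => u₀)
      (measurable_snd.comp (measurable_subtype_coe.comp (hτ t))) measurable_const
      (measurableSet_Y M)
  · have h := (τ t ⟨y, hy⟩).2.2
    have h1 : (τ t ⟨y, hy⟩).1.1 = y := congrArg Subtype.val (hτp t ⟨y, hy⟩)
    simp only [dif_pos hy]
    rwa [h1] at h
  · funext t x
    refine Subtype.ext (Prod.ext ?_ ?_)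
    · exact (congrArg Subtype.val (hτp t x)).symm
    · simp [Plan.policy]

instance Model.nonempty_plan : Nonempty (Plan M) := by
  obtain ⟨σ, hσ, hσp, -⟩ := exists_measurable_section_isMin (continuous_baseState M)
    (surjective_baseState M) (q := fun _ => 0) lowerSemicontinuous_const
  obtain ⟨π, -⟩ := exists_plan_policy_eq (fun _ => σ) (fun _ => hσ) fun _ => hσp
  exact ⟨π⟩

/-- The law of the state is the push forward of the transition kernel of the policy. -/
theorem stateLaw_eq_map (t : ℕ) (π : Plan M) (x : M.Y) :
    stateLaw M t π.π x =
      (stepKernel t (policyKernel (transition M) π.policy π.measurable_policy) x).map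
        Subtype.val := by
  induction t generalizing π x with
  | zero =>
    rw [stepKernel, Kernel.id_apply]
    exact (Measure.map_dirac' measurable_subtype_coe x).symm
  | succ t ih =>
    let K := stepKernel t
      (policyKernel (transition M) π.shift.policy π.shift.measurable_policy)
    have hK : (fun y : M.Y => stateLaw M t π.shift.π y) = K.map Subtype.val := by
      funext y
      rw [ih, Kernel.map_apply _ measurable_subtype_coe]
    have hν : (M.ν.map fun s => M.f x (π.π 0 x) s) =
        (transition M (π.policy 0 x)).map Subtype.val := by
      rw [transition_apply, Measure.map_map measurable_subtype_coe (measurable_nextState M _)]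
      rfl
    have hae : AEMeasurable (fun y => stateLaw M t π.shift.π y)
        ((transition M (π.policy 0 x)).map Subtype.val) := by
      rw [(measurableEmbedding_state M).aemeasurable_map_iff]
      have : Measurable (fun y : M.Y => stateLaw M t π.shift.π y) := by
        rw [hK]
        exact Kernel.measurable _
      exact this.aemeasurable
    calc stateLaw M (t + 1) π.π x
        = ((transition M (π.policy 0 x)).map Subtype.val).bind
            fun y => stateLaw M t π.shift.π y := by rw [← hν]; rfl
      _ = (transition M (π.policy 0 x)).bind (K.map Subtype.val) := by
          rw [Measure.bind, AEMeasurable.map_map_of_aemeasurable hae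
            measurable_subtype_coe.aemeasurable, ← hK]
          rfl
      _ = ((K ∘ₖ policyKernel (transition M) π.policy π.measurable_policy 0).map
            Subtype.val) x := by
          rw [Kernel.map_comp, Kernel.comp_apply]
          rfl
      _ = _ := by
          rw [Kernel.map_apply _ measurable_subtype_coe]
          rfl

/-- The running cost as a function on the graph. -/
def graphCost (M : Model n Uc S) (k : (Fin n → ℝ) → Uc → ℝ) (g : graphG M) : ℝ := k g.1.1 g.1.2

theorem continuous_graphCost {k : (Fin n → ℝ) → Uc → ℝ}
    (hk : ContinuousOn (fun p : (Fin n → ℝ) × Uc => k p.1 p.2) (M.Y ×ˢ (univ : Set Uc))) :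
    Continuous (graphCost M k) :=
  hk.comp_continuous continuous_subtype_val fun g => ⟨g.2.1, mem_univ _⟩

theorem expSA_eq_stepCost {k : (Fin n → ℝ) → Uc → ℝ} (hk : Continuous (graphCost M k)) (t : ℕ)
    (π : Plan M) (x : M.Y) :
    expSA M t π.π x k =
      stepCost (transition M) (graphCost M k) π.policy π.measurable_policy t x := by
  have h : saLaw M t π.π x = ((stepKernel t (policyKernel (transition M) π.policy
      π.measurable_policy) x).map (π.policy t)).map Subtype.val := by
    rw [saLaw, stateLaw_eq_map, Measure.map_map measurable_subtype_coe (π.measurable_policy t),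
      Measure.map_map (measurable_id'.prodMk (π.measurable t)) measurable_subtype_coe]
    rfl
  rw [expSA, h, (measurableEmbedding_graphG M).integral_map]
  exact integral_map (π.measurable_policy t).aemeasurable hk.aestronglyMeasurable

/-- Discounted stationary measures on the ambient space and on the graph have the same costs. -/
theorem image_Weps_eq (k : (Fin n → ℝ) → Uc → ℝ) (ε : ℝ) (x : M.Y) :
    (fun γ : Measure ((Fin n → ℝ) × Uc) => ∫ p, k p.1 p.2 ∂γ) '' Weps M ε x =
      (fun γ : ProbabilityMeasure (graphG M) => ∫ g, graphCost M k g ∂(γ : Measure (graphG M))) ''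
        balanceSet (baseState M) (transition M) ε x := by
  have hE := measurableEmbedding_graphG M
  have hEf : ∀ (φ : (Fin n → ℝ) → ℝ), Continuous φ → ∀ g : graphG M,
      Ef M φ g.1.1 g.1.2 = ∫ x, φ x ∂transition M g := fun φ hφ g =>
    (integral_transition M (hφ.comp continuous_subtype_val) g).symm
  have hbal : ∀ γ : Measure (graphG M),
      (∀ φ : (Fin n → ℝ) → ℝ, Continuous φ → ∫ p, ((1 - ε) * (Ef M φ p.1 p.2 - φ p.1)
        + ε * (φ x - φ p.1)) ∂γ.map Subtype.val = 0) ↔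
      ∀ φ : M.Y → ℝ, Continuous φ → ∫ g, ((1 - ε) * (∫ x, φ x ∂transition M g
        - φ (baseState M g)) + ε * (φ x - φ (baseState M g))) ∂γ = 0 := by
    intro γ
    have hmap : ∀ φ : (Fin n → ℝ) → ℝ, Continuous φ →
        ∫ p, ((1 - ε) * (Ef M φ p.1 p.2 - φ p.1) + ε * (φ x - φ p.1)) ∂γ.map Subtype.val =
        ∫ g, ((1 - ε) * (∫ x : M.Y, φ x ∂transition M g - φ (baseState M g))
          + ε * (φ x - φ (baseState M g))) ∂γ := by
      intro φ hφ
      rw [hE.integral_map]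
      simp only [hEf φ hφ]
      rfl
    constructor
    · intro h φ hφ
      obtain ⟨Φ, hΦ⟩ := ContinuousMap.exists_restrict_eq M.Y_compact.isClosed ⟨φ, hφ⟩
      have hΦ' : ∀ y : M.Y, Φ y = φ y := fun y => DFunLike.congr_fun hΦ y
      have := h Φ Φ.continuous
      rw [hmap Φ Φ.continuous] at this
      simpa only [hΦ'] using this
    · intro h φ hφ
      rw [hmap φ hφ]
      exact h (fun y => φ y) (hφ.comp continuous_subtype_val)
  ext r
  constructor
  · rintro ⟨γ, ⟨hγ, hon, hγb⟩, rfl⟩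
    have hmc : (γ.comap Subtype.val : Measure (graphG M)).map Subtype.val = γ := by
      rw [hE.map_comap, Subtype.range_coe, Measure.restrict_eq_self_of_ae_mem]
      exact hon
    have hprob : IsProbabilityMeasure (γ.comap Subtype.val : Measure (graphG M)) := by
      constructor
      rw [← preimage_univ (f := (Subtype.val : graphG M → _)),
        ← Measure.map_apply measurable_subtype_coe MeasurableSet.univ, hmc, measure_univ]
    refine ⟨⟨_, hprob⟩, (hbal (γ.comap Subtype.val)).mp (by rwa [hmc]), ?_⟩
    change ∫ g, graphCost M k g ∂(γ.comap Subtype.val : Measure (graphG M)) = ∫ p, k p.1 p.2 ∂γ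
    conv_rhs => rw [← hmc]
    rw [hE.integral_map]
    rfl
  · rintro ⟨γ, hγ, rfl⟩
    refine ⟨(γ : Measure (graphG M)).map Subtype.val, ⟨?_, ?_, (hbal _).mpr hγ⟩, ?_⟩
    · exact Measure.isProbabilityMeasure_map measurable_subtype_coe.aemeasurable
    · rw [onG, Measure.map_apply measurable_subtype_coe (measurableSet_graphG M).compl]
      simp
    · change ∫ p, k p.1 p.2 ∂(γ : Measure (graphG M)).map Subtype.val = _
      rw [hE.integral_map]
      rfl

end Plans

section Values

open ProbabilityTheory

variable {M : Model n Uc S} {k : (Fin n → ℝ) → Uc → ℝ}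

theorem costDisc_eq_tsum (hk : Continuous (graphCost M k)) (ε : ℝ) (π : Plan M) (x : M.Y) :
    costDisc M k ε π.π x = ε * ∑' t, (1 - ε) ^ t *
      stepCost (transition M) (graphCost M k) π.policy π.measurable_policy t x := by
  simp only [costDisc, expSA_eq_stepCost hk]

theorem costT_eq_sum (hk : Continuous (graphCost M k)) (T : ℕ) (π : Plan M) (x : M.Y) :
    costT M k T π.π x = (1 / (T : ℝ)) * ∑ t ∈ Finset.range T,
      stepCost (transition M) (graphCost M k) π.policy π.measurable_policy t x := by
  simp only [costT, expSA_eq_stepCost hk]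

/-- The discounted cost of a plan is the cost of its discounted occupational measure. -/
theorem exists_mem_balanceSet_integral_eq_costDisc (hk : Continuous (graphCost M k)) {ε : ℝ}
    (hε : ε ∈ Ioo (0 : ℝ) 1) (π : Plan M) (x : M.Y) :
    ∃ γ ∈ balanceSet (baseState M) (transition M) ε x,
      ∫ g, graphCost M k g ∂(γ : Measure (graphG M)) = costDisc M k ε π.π x := by
  rw [costDisc_eq_tsum hk]
  exact exists_discountedOccupation (continuous_baseState M) _ (continuous_integral_transition M)
    π.policy π.measurable_policy π.baseState_policy hε.1 hε.2 x hk

/-- The finite horizon cost of a plan is the cost of an almost stationary measure. -/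
theorem exists_integral_eq_costT (hk : Continuous (graphCost M k)) {T : ℕ} (hT : 0 < T)
    (π : Plan M) (x : M.Y) :
    ∃ γ : ProbabilityMeasure (graphG M),
      (∀ φ : M.Y → ℝ, Continuous φ → ∀ B : ℝ, (∀ x, |φ x| ≤ B) →
        |∫ g, ∫ x, φ x ∂transition M g ∂(γ : Measure (graphG M))
          - ∫ g, φ (baseState M g) ∂(γ : Measure (graphG M))| ≤ 2 * B / T) ∧
      ∫ g, graphCost M k g ∂(γ : Measure (graphG M)) = costT M k T π.π x := by
  rw [costT_eq_sum hk]
  exact exists_finiteOccupation (continuous_baseState M) _ (continuous_integral_transition M)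
    π.policy π.measurable_policy π.baseState_policy hT x hk

variable {C : ℝ} (hk : Continuous (graphCost M k)) (hkC : ∀ g, |graphCost M k g| ≤ C)

include hkC in
theorem neg_le_integral_graphCost (γ : ProbabilityMeasure (graphG M)) :
    -C ≤ ∫ g, graphCost M k g ∂(γ : Measure (graphG M)) := by
  have h := norm_integral_le_of_norm_le_const (μ := (γ : Measure (graphG M)))
    (f := graphCost M k) (Eventually.of_forall hkC)
  exact (abs_le.mp (by simpa using h)).1

include hk hkC

theorem neg_le_costDisc {ε : ℝ} (hε : ε ∈ Ioo (0 : ℝ) 1) (π : Plan M) (x : M.Y) :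
    -C ≤ costDisc M k ε π.π x := by
  obtain ⟨γ, -, hγ⟩ := exists_mem_balanceSet_integral_eq_costDisc hk hε π x
  exact hγ ▸ neg_le_integral_graphCost hkC γ

theorem neg_le_costT {T : ℕ} (hT : 0 < T) (π : Plan M) (x : M.Y) : -C ≤ costT M k T π.π x := by
  obtain ⟨γ, -, hγ⟩ := exists_integral_eq_costT hk hT π x
  exact hγ ▸ neg_le_integral_graphCost hkC γ

theorem hEps_le_costDisc {ε : ℝ} (hε : ε ∈ Ioo (0 : ℝ) 1) (π : Plan M) (x : M.Y) :
    hEps M k ε x ≤ costDisc M k ε π.π x :=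
  ciInf_le ⟨-C, by rintro _ ⟨π', rfl⟩; exact neg_le_costDisc hk hkC hε π' x⟩ π

theorem vT_le_costT {T : ℕ} (hT : 0 < T) (π : Plan M) (x : M.Y) :
    vT M k T x ≤ costT M k T π.π x :=
  ciInf_le ⟨-C, by rintro _ ⟨π', rfl⟩; exact neg_le_costT hk hkC hT π' x⟩ π

theorem sInf_hEps_le_costDisc {ε : ℝ} (hε : ε ∈ Ioo (0 : ℝ) 1) (π : Plan M) (x : M.Y) :
    sInf ((fun y => hEps M k ε y) '' M.Y) ≤ costDisc M k ε π.π x := by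
  refine (csInf_le ?_ (mem_image_of_mem (fun y => hEps M k ε y) x.2)).trans
    (hEps_le_costDisc hk hkC hε π x)
  refine ⟨-C, ?_⟩
  rintro _ ⟨y, hy, rfl⟩
  exact le_ciInf fun π' => neg_le_costDisc hk hkC hε π' ⟨y, hy⟩

theorem sInf_vT_le_costT {T : ℕ} (hT : 0 < T) (π : Plan M) (x : M.Y) :
    sInf ((fun y => vT M k T y) '' M.Y) ≤ costT M k T π.π x := by
  refine (csInf_le ?_ (mem_image_of_mem (fun y => vT M k T y) x.2)).trans
    (vT_le_costT hk hkC hT π x)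
  refine ⟨-C, ?_⟩
  rintro _ ⟨y, hy, rfl⟩
  exact le_ciInf fun π' => neg_le_costT hk hkC hT π' ⟨y, hy⟩

/-- A lower bound for the discounted costs of all plans, almost surely in the initial state, is a
lower bound for the costs of the corresponding discounted stationary measures. -/
theorem le_integral_graphCost_of_map_eq {ε : ℝ} (hε : ε ∈ Ioo (0 : ℝ) 1)
    (γ : ProbabilityMeasure (graphG M)) {ν₀ : Measure M.Y} [IsProbabilityMeasure ν₀]
    (hγ : (γ : Measure (graphG M)).map (baseState M) =
      ENNReal.ofReal (1 - ε) • (γ : Measure (graphG M)).bind (transition M) + ENNReal.ofReal ε • ν₀)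
    {m : ℝ} (hm : ∀ π : Plan M, ∀ᵐ x : M.Y ∂ν₀, m ≤ costDisc M k ε π.π x) :
    m ≤ ∫ g, graphCost M k g ∂(γ : Measure (graphG M)) := by
  refine le_integral_of_map_eq (continuous_baseState M) (surjective_baseState M) (transition M)
    (lowerSemicontinuous_lintegral_transition M) hk hkC hε.1 hε.2 hγ fun τ hτ hτp => ?_
  obtain ⟨π, rfl⟩ := exists_plan_policy_eq τ hτ hτp
  filter_upwards [hm π] with x hx
  rwa [costDisc_eq_tsum hk] at hx

theorem hEps_eq_kStarEps {ε : ℝ} (hε : ε ∈ Ioo (0 : ℝ) 1) (x : M.Y) :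
    hEps M k ε x = kStarEps M k ε x := by
  rw [kStarEps, image_Weps_eq]
  apply le_antisymm
  · obtain ⟨γ, hγ, -⟩ :=
      exists_mem_balanceSet_integral_eq_costDisc hk hε (Classical.arbitrary (Plan M)) x
    refine le_csInf ⟨_, γ, hγ, rfl⟩ ?_
    rintro _ ⟨γ', hγ', rfl⟩
    refine le_integral_graphCost_of_map_eq hk hkC hε γ' (ν₀ := Measure.dirac x)
      ((map_eq_iff_forall_integral (continuous_baseState M) _ (continuous_integral_transition M) _ _
        hε.1.le hε.2.le).mpr fun φ hφ => ?_) fun π => ?_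
    · simpa only [integral_dirac] using hγ' φ hφ
    · rw [ae_dirac_eq]
      exact hEps_le_costDisc hk hkC hε π x
  · refine le_ciInf fun π => ?_
    obtain ⟨γ, hγ, hγk⟩ := exists_mem_balanceSet_integral_eq_costDisc hk hε π x
    refine csInf_le ⟨-C, ?_⟩ ⟨γ, hγ, hγk⟩
    rintro _ ⟨γ', -, rfl⟩
    exact neg_le_integral_graphCost hkC γ'

omit hk hkC in
theorem kStar_eq_sInf_balanceSet (x : M.Y) : kStar M k =
    sInf ((fun γ : ProbabilityMeasure (graphG M) =>
      ∫ g, graphCost M k g ∂(γ : Measure (graphG M))) ''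
        balanceSet (baseState M) (transition M) 0 x) := by
  have hW : Wset M = Weps M 0 x := by simp [Wset, Weps]
  rw [← image_Weps_eq, ← hW, kStar]

omit hk hkC in
theorem map_baseState_eq_bind {x : M.Y} {γ : ProbabilityMeasure (graphG M)}
    (hγ : γ ∈ balanceSet (baseState M) (transition M) 0 x) :
    (γ : Measure (graphG M)).map (baseState M) =
      (γ : Measure (graphG M)).bind (transition M) := by
  have h := (map_eq_iff_forall_integral (continuous_baseState M) (transition M)
    (continuous_integral_transition M) (γ : Measure (graphG M)) (Measure.dirac x) le_rfl
    zero_le_one).mpr fun φ hφ => by simpa only [integral_dirac] using hγ φ hφ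
  simpa using h

theorem tendsto_sInf_hEps :
    Tendsto (fun ε : ℝ => sInf ((fun y => hEps M k ε y) '' M.Y)) (𝓝[Ioo (0 : ℝ) 1] 0)
      (𝓝 (kStar M k)) := by
  obtain x₀ : M.Y := Classical.arbitrary _
  rw [kStar_eq_sInf_balanceSet x₀]
  have hne : Nonempty (ProbabilityMeasure (graphG M)) :=
    ⟨⟨Measure.dirac (Classical.arbitrary _), inferInstance⟩⟩
  have hex : ∀ ε ∈ Ioo (0 : ℝ) 1, ∃ (γ : ProbabilityMeasure (graphG M)) (x : M.Y),
      γ ∈ balanceSet (baseState M) (transition M) ε x ∧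
      ∫ g, graphCost M k g ∂(γ : Measure (graphG M)) ≤
        sInf ((fun y => hEps M k ε y) '' M.Y) + ε := by
    intro ε hε
    obtain ⟨_, ⟨y, hy, rfl⟩, hlt⟩ := exists_lt_of_csInf_lt (M.Y_nonempty.image _)
      (lt_add_of_pos_right (sInf ((fun y => hEps M k ε y) '' M.Y)) hε.1)
    obtain ⟨π, hπ⟩ := exists_lt_of_ciInf_lt hlt
    obtain ⟨γ, hγ, hγk⟩ := exists_mem_balanceSet_integral_eq_costDisc hk hε π ⟨y, hy⟩
    exact ⟨γ, ⟨y, hy⟩, hγ, hγk.le.trans hπ.le⟩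
  choose! γ x hγ hγk using hex
  have hmem : ∀ᶠ ε in 𝓝[Ioo (0 : ℝ) 1] 0, ε ∈ Ioo (0 : ℝ) 1 := self_mem_nhdsWithin
  have hid : Tendsto (fun ε : ℝ => ε) (𝓝[Ioo (0 : ℝ) 1] 0) (𝓝 0) :=
    tendsto_id.mono_left nhdsWithin_le_nhds
  refine tendsto_sInf_stationary (continuous_baseState M) (transition M)
    (continuous_integral_transition M) hk x₀ (γ := γ) hid (hmem.mono hγk) (fun φ hφ => ?_) ?_
  · obtain ⟨B, hB⟩ := isCompact_univ.exists_bound_of_continuousOn hφ.continuousOn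
    have hbound : Tendsto (fun ε : ℝ => 2 * B * ε / (1 - ε)) (𝓝[Ioo (0 : ℝ) 1] 0) (𝓝 0) := by
      have : ContinuousAt (fun ε : ℝ => 2 * B * ε / (1 - ε)) 0 := by
        refine ContinuousAt.div (by fun_prop) (by fun_prop) (by norm_num)
      simpa using this.tendsto.mono_left nhdsWithin_le_nhds
    refine squeeze_zero_norm' (hmem.mono fun ε hε => ?_) hbound
    have hbal := hγ ε hε φ hφ
    rw [integral_balance (continuous_baseState M) (transition M)
      (continuous_integral_transition M) hφ] at hbal
    have hint : |∫ g, φ (baseState M g) ∂(γ ε : Measure (graphG M))| ≤ B := by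
      simpa using norm_integral_le_of_norm_le_const (μ := (γ ε : Measure (graphG M)))
        (f := fun g => φ (baseState M g)) (Eventually.of_forall fun g => hB _ (mem_univ _))
    have hx : |φ (x ε)| ≤ B := hB _ (mem_univ _)
    have h1 : 0 < 1 - ε := by linarith [hε.2]
    rw [Real.norm_eq_abs, le_div_iff₀ h1, ← abs_of_pos h1, ← abs_mul, mul_comm,
      eq_neg_of_add_eq_zero_left hbal, abs_neg, abs_mul, abs_of_pos hε.1, mul_comm]
    exact mul_le_mul_of_nonneg_right ((abs_sub _ _).trans (by linarith)) hε.1.le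
  · filter_upwards [hmem] with ε hε γ' hγ'
    have := Measure.isProbabilityMeasure_map (μ := (γ' : Measure (graphG M)))
      (continuous_baseState M).measurable.aemeasurable
    refine le_integral_graphCost_of_map_eq hk hkC hε γ'
      (ν₀ := (γ' : Measure (graphG M)).map (baseState M)) ?_ fun π =>
        Eventually.of_forall fun x => sInf_hEps_le_costDisc hk hkC hε π x
    rw [← map_baseState_eq_bind hγ', ← add_smul,
      ← ENNReal.ofReal_add (by linarith [hε.2]) hε.1.le, sub_add_cancel, ENNReal.ofReal_one,
      one_smul]

theorem tendsto_sInf_vT :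
    Tendsto (fun T : ℕ => sInf ((fun y => vT M k T y) '' M.Y)) atTop (𝓝 (kStar M k)) := by
  obtain x₀ : M.Y := Classical.arbitrary _
  rw [kStar_eq_sInf_balanceSet x₀]
  have hne : Nonempty (ProbabilityMeasure (graphG M)) :=
    ⟨⟨Measure.dirac (Classical.arbitrary _), inferInstance⟩⟩
  have hex : ∀ T : ℕ, 0 < T → ∃ γ : ProbabilityMeasure (graphG M),
      (∀ φ : M.Y → ℝ, Continuous φ → ∀ B : ℝ, (∀ x, |φ x| ≤ B) →
        |∫ g, ∫ x, φ x ∂transition M g ∂(γ : Measure (graphG M))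
          - ∫ g, φ (baseState M g) ∂(γ : Measure (graphG M))| ≤ 2 * B / T) ∧
      ∫ g, graphCost M k g ∂(γ : Measure (graphG M)) ≤
        sInf ((fun y => vT M k T y) '' M.Y) + 1 / (T : ℝ) := by
    intro T hT
    have hT' : 0 < 1 / (T : ℝ) := by positivity
    obtain ⟨_, ⟨y, hy, rfl⟩, hlt⟩ := exists_lt_of_csInf_lt (M.Y_nonempty.image _)
      (lt_add_of_pos_right (sInf ((fun y => vT M k T y) '' M.Y)) hT')
    obtain ⟨π, hπ⟩ := exists_lt_of_ciInf_lt hlt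
    obtain ⟨γ, hγ, hγk⟩ := exists_integral_eq_costT hk hT π ⟨y, hy⟩
    exact ⟨γ, hγ, hγk.le.trans hπ.le⟩
  choose! γ hγ hγk using hex
  refine tendsto_sInf_stationary (continuous_baseState M) (transition M)
    (continuous_integral_transition M) hk x₀ (γ := γ) (tendsto_const_div_atTop_nhds_zero_nat 1)
    ((eventually_gt_atTop 0).mono hγk) (fun φ hφ => ?_) ?_
  · obtain ⟨B, hB⟩ := isCompact_univ.exists_bound_of_continuousOn hφ.continuousOn
    exact squeeze_zero_norm' ((eventually_gt_atTop 0).mono fun T hT =>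
      hγ T hT φ hφ B fun x => hB x (mem_univ _)) (tendsto_const_div_atTop_nhds_zero_nat _)
  · filter_upwards [eventually_gt_atTop 0] with T hT γ' hγ'
    have hT' : (0 : ℝ) < T := by positivity
    refine le_of_mul_le_mul_left (mul_le_mul_integral_of_map_eq (continuous_baseState M)
      (surjective_baseState M) (transition M) (lowerSemicontinuous_lintegral_transition M) hk hkC
      (map_baseState_eq_bind hγ') T fun τ hτ hτp x => ?_) hT'
    obtain ⟨π, rfl⟩ := exists_plan_policy_eq τ hτ hτp
    have h := sInf_vT_le_costT hk hkC hT π x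
    rw [costT_eq_sum hk, one_div_mul_eq_div, le_div_iff₀' hT'] at h
    exact h

end Values

/-- (i) `h_ε(y₀) = k*(ε,y₀)` for all `ε ∈ (0,1)`, `y₀ ∈ Y`;
(ii) `lim_{ε→0} min_{y₀∈Y} h_ε(y₀) = k*`; (iii) `lim_{T→∞} min_{y₀∈Y} v_T(y₀) = k*`. -/
theorem statement5 (M : Model n Uc S) (k : (Fin n → ℝ) → Uc → ℝ)
    (hk : ContinuousOn (fun p : (Fin n → ℝ) × Uc => k p.1 p.2) (M.Y ×ˢ (univ : Set Uc)))
    (C : ℝ) (hkC : ∀ y ∈ M.Y, ∀ u : Uc, |k y u| ≤ C) :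
    (∀ ε ∈ Set.Ioo (0 : ℝ) 1, ∀ y0 ∈ M.Y, hEps M k ε y0 = kStarEps M k ε y0) ∧
    Tendsto (fun ε : ℝ => sInf ((fun y0 => hEps M k ε y0) '' M.Y))
      (𝓝[Set.Ioo (0 : ℝ) 1] 0) (𝓝 (kStar M k)) ∧
    Tendsto (fun T : ℕ => sInf ((fun y0 => vT M k T y0) '' M.Y)) atTop (𝓝 (kStar M k)) := by
  have hc := continuous_graphCost hk
  have hb : ∀ g, |graphCost M k g| ≤ C := fun g => hkC _ g.2.1 _
  exact ⟨fun ε hε y hy => hEps_eq_kStarEps hc hb hε ⟨y, hy⟩, tendsto_sInf_hEps hc hb,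
    tendsto_sInf_vT hc hb⟩

end StochLP
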